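/- Let p, n ∈ ℤ⁺ with n ≥ 2, let 0 < α ≤ 2 and K > 0, and let 1 ≤ s ≤ p. For any ε ∈ (0,1) there exist constants C₁, C₂, C₃, C₄ > 0 depending only on α, K and ε such that the test φ_{G,sparse} := 1{max_{t∈T∖{1}} A_{t,a} > r} ∨ 1{A_{1,a} > r₁} with a = C₁(log^{1/α}(ep/s) + s^{−1/2}·log^{1/2}(log(8n))), r = C₂(√(s·log log(8n)) + log log(8n)) and r₁ = C₃·s·log^{2/α}(ep/s) satisfies R_{G_{α,K}^⊗}(ρ, φ_{G,sparse}) ≤ ε whenever ρ² ≥ C₄(s·log^{2/α}(ep/s) + log log(8n)). -/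

import Mathlib

open MeasureTheory
open scoped Classical

namespace ChangePoint

noncomputable section

/-- The `i`-th column (0-based) of the data matrix, with out-of-range guard. -/
def col (p n : ℕ) (X : Fin n → Fin p → ℝ) (i : ℕ) : Fin p → ℝ :=
  if h : i < n then X ⟨i, h⟩ else 0

/-- ℓ₀-"norm": the number of nonzero coordinates. -/
def l0 (p : ℕ) (v : Fin p → ℝ) : ℕ :=
  (Finset.univ.filter fun j : Fin p => v j ≠ 0).card

/-- Squared Euclidean norm on `ℝ^p`. -/
def sqnorm (p : ℕ) (v : Fin p → ℝ) : ℝ := ∑ j, v j ^ 2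

/-- The iterated logarithm `log log (8 n)`. -/
def LL (n : ℕ) : ℝ := Real.log (Real.log (8 * n))

/-- The sub-Weibull class `𝒢_{α,K}` of distributions on `ℝ`:
mean `0`, variance `1` and `𝔼 exp (|W/K|^α) ≤ 2`. -/
def memG (α K : ℝ) (ν : Measure ℝ) : Prop :=
  IsProbabilityMeasure ν ∧ Integrable id ν ∧ (∫ x, x ∂ν) = 0 ∧
    (∫⁻ x, ENNReal.ofReal (x ^ 2) ∂ν) = 1 ∧
    (∫⁻ x, ENNReal.ofReal (Real.exp (|x / K| ^ α)) ∂ν) ≤ 2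

/-- The polynomially-tailed class `𝒫_{α,K}` of distributions on `ℝ`:
mean `0`, variance `1` and `𝔼 |W/K|^α ≤ 1`. -/
def memP (α K : ℝ) (ν : Measure ℝ) : Prop :=
  IsProbabilityMeasure ν ∧ Integrable id ν ∧ (∫ x, x ∂ν) = 0 ∧
    (∫⁻ x, ENNReal.ofReal (x ^ 2) ∂ν) = 1 ∧
    (∫⁻ x, ENNReal.ofReal (|x / K| ^ α) ∂ν) ≤ 1

/-- `P` is the joint law on `ℝ^{p×n}` of `p·n` independent entries with marginal laws `ν t j`
(characterised on measurable rectangles). -/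
def IsEntrywiseProduct (p n : ℕ) (P : Measure (Fin n → Fin p → ℝ))
    (ν : Fin n → Fin p → Measure ℝ) : Prop :=
  IsProbabilityMeasure P ∧
    ∀ s : Fin n → Fin p → Set ℝ, (∀ t j, MeasurableSet (s t j)) →
      P {x | ∀ t j, x t j ∈ s t j} = ∏ t, ∏ j, ν t j (s t j)

/-- The class `𝒢_{α,K}^⊗` of noise distributions. -/
def Gclass (p n : ℕ) (α K : ℝ) : Set (Measure (Fin n → Fin p → ℝ)) :=
  {P | ∃ ν : Fin n → Fin p → Measure ℝ, (∀ t j, memG α K (ν t j)) ∧ IsEntrywiseProduct p n P ν}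

/-- The class `𝒫_{α,K}^⊗` of noise distributions. -/
def Pclass (p n : ℕ) (α K : ℝ) : Set (Measure (Fin n → Fin p → ℝ)) :=
  {P | ∃ ν : Fin n → Fin p → Measure ℝ, (∀ t j, memP α K (ν t j)) ∧ IsEntrywiseProduct p n P ν}

/-- The null parameter space `Θ₀(p,n)`: constant signal. -/
def Theta0 (p n : ℕ) : Set (Fin n → Fin p → ℝ) :=
  {θ | ∃ μ : Fin p → ℝ, ∀ t, θ t = μ}

/-- `Θ^{(t₀)}(p,n,s,ρ)`: a single mean change at (1-based) time `t0` of sparsity `s` and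
normalized signal strength at least `ρ`. -/
def ThetaAt (p n t0 s : ℕ) (ρ : ℝ) : Set (Fin n → Fin p → ℝ) :=
  {θ | ∃ μ₁ μ₂ : Fin p → ℝ,
    (∀ t : Fin n, (t : ℕ) < t0 → θ t = μ₁) ∧
    (∀ t : Fin n, t0 ≤ (t : ℕ) → θ t = μ₂) ∧
    l0 p (fun j => μ₁ j - μ₂ j) ≤ s ∧
    ρ ^ 2 ≤ (t0 : ℝ) * ((n : ℝ) - (t0 : ℝ)) / (n : ℝ) * sqnorm p (fun j => μ₁ j - μ₂ j)}

/-- The single-change-point alternative `Θ(p,n,s,ρ)`. -/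
def Theta1 (p n s : ℕ) (ρ : ℝ) : Set (Fin n → Fin p → ℝ) :=
  ⋃ t0 ∈ Finset.Icc 1 (n - 1), ThetaAt p n t0 s ρ

/-- A (randomized-free) test: a measurable `{0,1}`-valued function of the data. -/
def IsTest (p n : ℕ) (φ : (Fin n → Fin p → ℝ) → ℝ) : Prop :=
  Measurable φ ∧ ∀ x, φ x = 0 ∨ φ x = 1

/-- The worst-case testing error of the test `φ` for null `Θ₀(p,n)` against the
alternative `Θalt`, over the noise class `Q`. -/
def risk (p n : ℕ) (Q : Set (Measure (Fin n → Fin p → ℝ)))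
    (Θalt : Set (Fin n → Fin p → ℝ)) (φ : (Fin n → Fin p → ℝ) → ℝ) : ℝ :=
  (⨆ P ∈ Q, ⨆ θ ∈ Theta0 p n, ∫ E, φ (θ + E) ∂P) +
  (⨆ P ∈ Q, ⨆ θ ∈ Θalt, ∫ E, (1 - φ (θ + E)) ∂P)

/-- The dyadic grid `𝒯 = {1,2,4,…,2^{⌊log₂(n/2)⌋}}`. -/
def Tgrid (n : ℕ) : Finset ℕ :=
  (Finset.range (Nat.log 2 (n / 2) + 1)).image fun k => 2 ^ k

/-- The CUSUM-type statistic `Y_t`. -/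
def Yt (p n : ℕ) (X : Fin n → Fin p → ℝ) (t : ℕ) (j : Fin p) : ℝ :=
  (∑ i ∈ Finset.range t, (col p n X i j - col p n X (n - 1 - i) j)) / Real.sqrt (2 * t)

/-- `A_t = ∑_j (Y_t(j)² − 1)`. -/
def At (p n : ℕ) (X : Fin n → Fin p → ℝ) (t : ℕ) : ℝ :=
  ∑ j, (Yt p n X t j ^ 2 - 1)

/-- The dense sub-Weibull test `φ_{𝒢,dense}` with threshold `r`. -/
def phiGdense (p n : ℕ) (r : ℝ) (X : Fin n → Fin p → ℝ) : ℝ :=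
  if ∃ t ∈ Tgrid n, r < At p n X t then 1 else 0

/-- Sample-splitting statistic `Y_{t,1}` (odd-indexed observations). -/
def Yt1 (p n : ℕ) (X : Fin n → Fin p → ℝ) (t : ℕ) (j : Fin p) : ℝ :=
  (∑ i ∈ Finset.range (t / 2), (col p n X (2 * i) j - col p n X (n - 1 - 2 * i) j)) /
    Real.sqrt t

/-- Sample-splitting statistic `Y_{t,2}` (even-indexed observations). -/
def Yt2 (p n : ℕ) (X : Fin n → Fin p → ℝ) (t : ℕ) (j : Fin p) : ℝ :=
  (∑ i ∈ Finset.range (t / 2), (col p n X (2 * i + 1) j - col p n X (n - 2 - 2 * i) j)) /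
    Real.sqrt t

/-- `Y_1 = (X_1 − X_n)/√2`. -/
def Y1 (p n : ℕ) (X : Fin n → Fin p → ℝ) (j : Fin p) : ℝ :=
  (col p n X 0 j - col p n X (n - 1) j) / Real.sqrt 2

/-- The hard-thresholded statistic `A_{t,a}`. -/
def Ata (p n : ℕ) (X : Fin n → Fin p → ℝ) (t : ℕ) (a : ℝ) : ℝ :=
  if t = 1 then ∑ j, (Y1 p n X j ^ 2 - 1) * (if a ≤ |Y1 p n X j| then 1 else 0)
  else ∑ j, (Yt1 p n X t j ^ 2 - 1) * (if a ≤ |Yt2 p n X t j| then 1 else 0)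

/-- The sparse sub-Weibull test `φ_{𝒢,sparse}` with threshold parameters `a, r, r₁`. -/
def phiGsparse (p n : ℕ) (a r r₁ : ℝ) (X : Fin n → Fin p → ℝ) : ℝ :=
  if (∃ t ∈ Tgrid n, t ≠ 1 ∧ r < Ata p n X t a) ∨ r₁ < Ata p n X 1 a then 1 else 0

/-- The median of a list of reals: its `⌈m/2⌉`-th smallest element. -/
def median (l : List ℝ) : ℝ :=
  (l.insertionSort (· ≤ ·)).getD ((l.length + 1) / 2 - 1) 0

/-- `Z_i = (X_i − X_{n+1−i})/√2` (0-based index `i`). -/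
def Zb (p n : ℕ) (X : Fin n → Fin p → ℝ) (i : ℕ) (j : Fin p) : ℝ :=
  (col p n X i j - col p n X (n - 1 - i) j) / Real.sqrt 2

/-- Mean of the `g`-th (0-based) of `G` consecutive equal-size groups of `Z_1,…,Z_t`. -/
def groupMean (p n : ℕ) (X : Fin n → Fin p → ℝ) (t G g : ℕ) (j : Fin p) : ℝ :=
  (∑ i ∈ Finset.range (t / G), Zb p n X (g * (t / G) + i) j) / ((t / G : ℕ) : ℝ)

/-- The median-of-means statistic `A_t^{MoM}` with `G` groups. -/
def AMoM (p n : ℕ) (X : Fin n → Fin p → ℝ) (t G : ℕ) : ℝ :=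
  (t : ℝ) * median (List.ofFn fun g : Fin G =>
    ∑ j, (groupMean p n X t G (g : ℕ) j ^ 2 - (G : ℝ) / (t : ℝ)))

/-- `Δ = 2^{3+⌈log₂ log log (8n)⌉}`. -/
def DeltaDense (n : ℕ) : ℕ := 2 ^ (3 + (Int.ceil (Real.logb 2 (LL n))).toNat)

/-- The dense median-of-means test `φ_{𝒫,dense}`. -/
def phiPdense (p n : ℕ) (α C₁ : ℝ) (X : Fin n → Fin p → ℝ) : ℝ :=
  if ∃ t ∈ Tgrid n,
      1 < AMoM p n X t (min t (DeltaDense n)) /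
        (C₁ * (p : ℝ) ^ max ((1 : ℝ) / 2) (2 / α) * ((min t (DeltaDense n) : ℕ) : ℝ))
  then 1 else 0

/-- `Δ = 2^{4+⌈log₂ log log (8n)⌉}`. -/
def DeltaSparse (n : ℕ) : ℕ := 2 ^ (4 + (Int.ceil (Real.logb 2 (LL n))).toNat)

/-- Mean of the `g`-th (0-based) of `G` consecutive equal-size groups of the odd-indexed
`Z_1, Z_3, …, Z_{t−1}`. -/
def groupMeanOdd (p n : ℕ) (X : Fin n → Fin p → ℝ) (t G g : ℕ) (j : Fin p) : ℝ :=
  (∑ i ∈ Finset.range (t / (2 * G)), Zb p n X (2 * (g * (t / (2 * G)) + i)) j) /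
    ((t / (2 * G) : ℕ) : ℝ)

/-- The hard-thresholded median-of-means statistic `A_{t,a}^{MoM}` with `G` groups. -/
def AMoMa (p n : ℕ) (X : Fin n → Fin p → ℝ) (t G : ℕ) (a : ℝ) : ℝ :=
  if t = 1 then ∑ j, (Zb p n X 0 j ^ 2 - 1) * (if a ≤ |Zb p n X 0 j| then 1 else 0)
  else ((t : ℝ) / 2) * median (List.ofFn fun g : Fin G =>
    ∑ j, (groupMeanOdd p n X t G (g : ℕ) j ^ 2 - 2 * (G : ℝ) / (t : ℝ)) *
      (if a ≤ |Yt2 p n X t j| then 1 else 0))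

/-- The sparse median-of-means test `φ_{𝒫,sparse}^{MoM}`. -/
def phiPsparseMoM (p n s : ℕ) (α C₁ C₂ : ℝ) (X : Fin n → Fin p → ℝ) : ℝ :=
  if ∃ t ∈ Tgrid n,
      1 < AMoMa p n X t (min t (DeltaSparse n) / 2)
            (C₁ * (((p : ℝ) / (s : ℝ)) ^ ((1 : ℝ) / α) +
              ((s : ℝ) ^ (-(1 : ℝ) / 2)) * Real.sqrt (LL n))) /
          (C₂ * (if t = 1 then (s : ℝ) * ((p : ℝ) / (s : ℝ)) ^ ((2 : ℝ) / α)
                 else Real.sqrt (s : ℝ) * ((min t (DeltaSparse n) / 2 : ℕ) : ℝ)))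
  then 1 else 0

/-- Condition RSM for `(α, K)` with constants `C₁, C₂`: statistical guarantee for a family
of (measurable) robust sparse mean estimators. -/
def CondRSM (p s : ℕ) (α K C₁ C₂ : ℝ)
    (est : (m : ℕ) → (Fin m → Fin p → ℝ) → ℝ → Fin p → ℝ) : Prop :=
  (∀ m : ℕ, Measurable fun Wη : (Fin m → Fin p → ℝ) × ℝ => est m Wη.1 Wη.2) ∧
  ∀ (m : ℕ) (μW : Fin p → ℝ) (ν : Fin m → Measure (Fin p → ℝ))
    (P : Measure (Fin m → Fin p → ℝ)) (η : ℝ),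
    0 < η → η < 1 → l0 p μW ≤ s →
    (∀ i, IsProbabilityMeasure (ν i)) →
    (∀ i j, Integrable (fun w => w j) (ν i) ∧ (∫ w, w j ∂ν i) = μW j) →
    (∀ i j k, Integrable (fun w => (w j - μW j) * (w k - μW k)) (ν i) ∧
      (∫ w, (w j - μW j) * (w k - μW k) ∂ν i) = if j = k then 1 else 0) →
    (∀ i j, (∫⁻ w, ENNReal.ofReal (|w j - μW j| ^ α) ∂ν i) ≤
      ENNReal.ofReal ((Real.sqrt 2 * K) ^ α)) →
    IsProbabilityMeasure P →
    (∀ S : Fin m → Set (Fin p → ℝ), (∀ i, MeasurableSet (S i)) →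
      P {W | ∀ i, W i ∈ S i} = ∏ i, ν i (S i)) →
    C₁ * ((s : ℝ) * Real.log (Real.exp 1 * (p : ℝ) / (s : ℝ)) + Real.log (1 / η)) ≤ (m : ℝ) →
    ENNReal.ofReal (1 - η) ≤
      P {W | Real.sqrt (sqnorm p fun j => est m W η j - μW j) ≤
        Real.sqrt C₂ * (Real.sqrt ((s : ℝ) * Real.log (Real.exp 1 * (p : ℝ) / (s : ℝ)) / (m : ℝ)) +
          Real.sqrt (Real.log (1 / η) / (m : ℝ)))}

/-- `Δ̃₁ = C₅ (s log(ep/s) + log(16/ε))`. -/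
def rsmDelta1 (p s : ℕ) (ε C₅ : ℝ) : ℝ :=
  C₅ * ((s : ℝ) * Real.log (Real.exp 1 * (p : ℝ) / (s : ℝ)) + Real.log (16 / ε))

/-- `Δ̃₂ = C₅ (s log(ep/s) + log(16 log(2n)/ε))`. -/
def rsmDelta2 (p s n : ℕ) (ε C₅ : ℝ) : ℝ :=
  C₅ * ((s : ℝ) * Real.log (Real.exp 1 * (p : ℝ) / (s : ℝ)) +
    Real.log (16 * Real.log (2 * (n : ℝ)) / ε))

/-- `a = C₃ ((p/s)^{1/α} + s^{−1/2} log^{1/2}(log Δ̃₁))`. -/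
def rsmA (p s : ℕ) (α ε C₃ C₅ : ℝ) : ℝ :=
  C₃ * (((p : ℝ) / (s : ℝ)) ^ ((1 : ℝ) / α) +
    ((s : ℝ) ^ (-(1 : ℝ) / 2)) * Real.sqrt (Real.log (Real.log (rsmDelta1 p s ε C₅))))

/-- The sparse test `φ^{RSM}_{𝒫,sparse}` built from a robust sparse mean estimator `est`. -/
def phiRSM (p n s : ℕ) (est : (m : ℕ) → (Fin m → Fin p → ℝ) → ℝ → Fin p → ℝ)
    (α ε C₃ C₄ C₅ C₆ : ℝ) (X : Fin n → Fin p → ℝ) : ℝ :=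
  if (∃ t ∈ Tgrid n, (t : ℝ) ≤ rsmDelta1 p s ε C₅ ∧
        1 < Ata p n X t (rsmA p s α ε C₃ C₅) /
          (C₄ * (if t = 1 then (s : ℝ) * ((p : ℝ) / (s : ℝ)) ^ ((2 : ℝ) / α)
                 else Real.sqrt ((s : ℝ) * Real.log (rsmDelta1 p s ε C₅))))) ∨
     (∃ t ∈ Tgrid n, rsmDelta1 p s ε C₅ < (t : ℝ) ∧
        1 < (t : ℝ) * sqnorm p (est t (fun i : Fin t => fun j => Zb p n X (i : ℕ) j)
              (Real.exp ((s : ℝ) * Real.log (Real.exp 1 * (p : ℝ) / (s : ℝ)) -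
                min (t : ℝ) (rsmDelta2 p s n ε C₅) / C₅))) /
          (C₆ * min (t : ℝ) (rsmDelta2 p s n ε C₅)))
  then 1 else 0

/-- The multiple-change-point alternative `Θ_multi(p,n,ρ)`. -/
def ThetaMulti (p n : ℕ) (ρ : ℝ) : Set (Fin n → Fin p → ℝ) :=
  {θ | ∃ k : ℕ, 1 ≤ k ∧ ∃ τ : ℕ → ℕ, ∃ μ : ℕ → Fin p → ℝ,
    τ 0 = 0 ∧ τ (k + 1) = n ∧ (∀ i ≤ k, τ i < τ (i + 1)) ∧
    (∀ i, 1 ≤ i → i ≤ k + 1 →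
      ∀ t : Fin n, τ (i - 1) ≤ (t : ℕ) → (t : ℕ) < τ i → θ t = μ i) ∧
    ∃ i, 1 ≤ i ∧ i ≤ k ∧
      4 * Real.log (n : ℝ) ≤ ((min (τ i - τ (i - 1)) (τ (i + 1) - τ i) : ℕ) : ℝ) ∧
      ρ ^ 2 ≤ sqnorm p (fun j => μ (i + 1) j - μ i j) *
        ((min (τ i - τ (i - 1)) (τ (i + 1) - τ i) : ℕ) : ℝ)}

/-- Membership in the temporal-dependence class `𝒫_Temp`: independent rows, entrywise
`𝒫_{α,K}` marginals, and exponentially decaying interlaced α-mixing coefficients. -/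
def memPTemp (p n : ℕ) (α K c₁ c₂ : ℝ) (P : Measure (Fin n → Fin p → ℝ)) : Prop :=
  IsProbabilityMeasure P ∧
  (∀ s : Fin p → Set (Fin n → ℝ), (∀ j, MeasurableSet (s j)) →
    P {x | ∀ j, (fun t => x t j) ∈ s j} = ∏ j, P {x | (fun t => x t j) ∈ s j}) ∧
  (∀ t j, memP α K (P.map fun x => x t j)) ∧
  (∀ i : ℕ, 1 ≤ i → i ≤ n - 1 →
    ∀ S T : Set (Fin n),
      (∀ s' ∈ S, ∀ t' ∈ T, (i : ℤ) ≤ |((s' : ℕ) : ℤ) - ((t' : ℕ) : ℤ)|) →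
      ∀ A B : Set (Fin n → Fin p → ℝ),
        MeasurableSet[MeasurableSpace.comap (fun x (t : S) => x t.1) inferInstance] A →
        MeasurableSet[MeasurableSpace.comap (fun x (t : T) => x t.1) inferInstance] B →
        |(P (A ∩ B)).toReal - (P A).toReal * (P B).toReal| ≤ c₁ * Real.exp (-c₂ * (i : ℝ)))

/-- The class `𝒲_α` of distributions on `ℝ^p`: centered with `𝔼|⟨W,v⟩|^α ≤ 1` for
every unit vector `v`. -/
def memW (p : ℕ) (α : ℝ) (ν : Measure (Fin p → ℝ)) : Prop :=
  IsProbabilityMeasure ν ∧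
  (∀ j, Integrable (fun w => w j) ν ∧ (∫ w, w j ∂ν) = 0) ∧
  ∀ v : Fin p → ℝ, sqnorm p v = 1 →
    (∫⁻ w, ENNReal.ofReal (|∑ j, w j * v j| ^ α) ∂ν) ≤ 1

/-- The class `𝒲_α^⊗`: independent columns with distributions in `𝒲_α`. -/
def Wclass (p n : ℕ) (α : ℝ) : Set (Measure (Fin n → Fin p → ℝ)) :=
  {P | ∃ ν : Fin n → Measure (Fin p → ℝ), (∀ t, memW p α (ν t)) ∧
    IsProbabilityMeasure P ∧
    ∀ s : Fin n → Set (Fin p → ℝ), (∀ t, MeasurableSet (s t)) →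
      P {x | ∀ t, x t ∈ s t} = ∏ t, ν t (s t)}

/-- The alternative `⋃_{t₀=1}^{n−1} Θ(p,n,ρ_{t₀})` for a location-dependent signal
strength sequence `ρ`. -/
def ThetaSeq (p n : ℕ) (ρ : ℕ → ℝ) : Set (Fin n → Fin p → ℝ) :=
  ⋃ t0 ∈ Finset.Icc 1 (n - 1),
    {θ | ∃ μ₁ μ₂ : Fin p → ℝ,
      (∀ t : Fin n, (t : ℕ) < t0 → θ t = μ₁) ∧
      (∀ t : Fin n, t0 ≤ (t : ℕ) → θ t = μ₂) ∧
      (ρ t0) ^ 2 ≤ sqnorm p (fun j => μ₁ j - μ₂ j)}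

/-- The boundary-restricted alternative `Θ_res(p,n,s,ρ)`. -/
def ThetaRes (p n s : ℕ) (ρ tres : ℝ) : Set (Fin n → Fin p → ℝ) :=
  {θ | ∃ t0 : ℕ, tres + 1 ≤ (t0 : ℝ) ∧ (t0 : ℝ) ≤ (n : ℝ) - tres ∧ θ ∈ ThetaAt p n t0 s ρ}

/-- `t^res = 32 (log (e² p / s) + s^{−1} log log (8n))`. -/
def tRes (p n s : ℕ) : ℝ :=
  32 * (Real.log (Real.exp 1 ^ 2 * (p : ℝ) / (s : ℝ)) + LL n / (s : ℝ))

end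


open Finset in
/-- Moment bound for sums of independent centred variables, in terms of truncated exponential
series of the summands. -/
lemma abs_moment_sum_le {Ω ι : Type*} [MeasurableSpace Ω] {P : Measure Ω} [IsProbabilityMeasure P]
    (ξ : ι → Ω → ℝ) (hmeas : ∀ i (m : ℕ), MemLp (ξ i) m P)
    (hind : ∀ (s : Finset ι) (i : ι), i ∉ s →
      ProbabilityTheory.IndepFun (fun ω => ∑ k ∈ s, ξ k ω) (ξ i) P)
    (h0 : ∀ i, ∫ ω, ξ i ω ∂P = 0) {l g : ℝ} (hl : 0 < l) (hg : 0 ≤ g) (q : ℕ)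
    (hq : ∀ i, ∑ m ∈ Icc 2 q, l ^ m * (|∫ ω, ξ i ω ^ m ∂P| / m.factorial) ≤ g)
    (s : Finset ι) :
    ∀ j ≤ q, |∫ ω, (∑ k ∈ s, ξ k ω) ^ j ∂P| ≤ j.factorial * l⁻¹ ^ j * (1 + g) ^ #s := by
  induction s using Finset.induction_on with
  | empty =>
    intro j _
    rcases Nat.eq_zero_or_pos j with rfl | hj
    · simp
    · simp [hj.ne']; positivity
  | insert i s hi ih =>
    intro j hj
    have hS : ∀ m : ℕ, MemLp (fun ω => ∑ k ∈ s, ξ k ω) m P := fun m =>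
      memLp_finsetSum s fun k _ => hmeas k m
    have hint : ∀ m : ℕ, ∀ f : Ω → ℝ, MemLp f m P → Integrable (fun ω => f ω ^ m) P := by
      intro m f hf
      have := hf.integrable_norm_pow'
      refine this.mono (hf.1.pow m) (by simp)
    have hI := hind s i hi
    have hIp : ∀ a b : ℕ, ProbabilityTheory.IndepFun (fun ω => (∑ k ∈ s, ξ k ω) ^ a)
        (fun ω => ξ i ω ^ b) P := fun a b =>
      hI.comp (φ := fun x => x ^ a) (ψ := fun x => x ^ b) (by fun_prop) (by fun_prop)
    have hexp : ∫ ω, (∑ k ∈ insert i s, ξ k ω) ^ j ∂P = ∑ m ∈ range (j + 1),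
        (∫ ω, ξ i ω ^ m ∂P) * (∫ ω, (∑ k ∈ s, ξ k ω) ^ (j - m) ∂P) * (j.choose m) := by
      have : ∀ ω, (∑ k ∈ insert i s, ξ k ω) ^ j = ∑ m ∈ range (j + 1),
          (∑ k ∈ s, ξ k ω) ^ (j - m) * ξ i ω ^ m * (j.choose m) := by
        intro ω
        rw [sum_insert hi, add_pow]
        exact sum_congr rfl fun m _ => by ring
      simp_rw [this]
      rw [integral_finsetSum]
      · refine sum_congr rfl fun m _ => ?_
        rw [integral_mul_const, (hIp (j - m) m).integral_fun_mul_eq_mul_integral]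
        · ring
        · exact ((hS 1).1.pow _)
        · exact ((hmeas i 1).1.pow _)
      · intro m _
        refine Integrable.mul_const ?_ _
        exact (hIp (j - m) m).integrable_mul (hint _ _ (hS _)) (hint _ _ (hmeas i _))
    rw [hexp, card_insert_of_notMem hi]
    have hterm : ∀ m ∈ range (j + 1), |(∫ ω, ξ i ω ^ m ∂P) *
        (∫ ω, (∑ k ∈ s, ξ k ω) ^ (j - m) ∂P) * (j.choose m)| ≤
        (j.factorial * l⁻¹ ^ j * (1 + g) ^ #s) *
          (l ^ m * (|∫ ω, ξ i ω ^ m ∂P| / m.factorial)) := by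
      intro m hm
      have hmj : m ≤ j := Nat.lt_succ_iff.1 (mem_range.1 hm)
      have h1 := ih (j - m) (by omega)
      rw [abs_mul, abs_mul, Nat.abs_cast]
      calc _ ≤ |∫ ω, ξ i ω ^ m ∂P| * ((j - m).factorial * l⁻¹ ^ (j - m) * (1 + g) ^ #s) *
            (j.choose m) := by gcongr
        _ = _ := by
          have h2 : (j.factorial : ℝ) = j.choose m * m.factorial * (j - m).factorial := by
            exact_mod_cast (Nat.choose_mul_factorial_mul_factorial hmj).symm
          have h3 : l⁻¹ ^ j = l⁻¹ ^ (j - m) * l⁻¹ ^ m := by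
            rw [← pow_add, Nat.sub_add_cancel hmj]
          have h4 : (m.factorial : ℝ) ≠ 0 := by positivity
          have h5 : l⁻¹ ^ m * l ^ m = 1 := by rw [← mul_pow, inv_mul_cancel₀ hl.ne', one_pow]
          have h6 : (m.factorial : ℝ) * (|∫ ω, ξ i ω ^ m ∂P| / m.factorial) =
              |∫ ω, ξ i ω ^ m ∂P| := mul_div_cancel₀ _ h4
          rw [h2, h3]
          linear_combination (-(j.choose m * (j - m).factorial * l⁻¹ ^ (j - m) * (1 + g) ^ #s *
            m.factorial * (|∫ ω, ξ i ω ^ m ∂P| / m.factorial))) * h5 -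
            (j.choose m * (j - m).factorial * l⁻¹ ^ (j - m) * (1 + g) ^ #s) * h6
    refine (abs_sum_le_sum_abs _ _).trans ((sum_le_sum hterm).trans ?_)
    rw [← mul_sum, pow_succ, ← mul_assoc]
    have hbase : ∑ m ∈ range (j + 1), l ^ m * (|∫ ω, ξ i ω ^ m ∂P| / m.factorial) ≤ 1 + g := by
      have hsub : ∑ m ∈ range (j + 1), l ^ m * (|∫ ω, ξ i ω ^ m ∂P| / m.factorial) ≤
          ∑ m ∈ insert 0 (insert 1 (Icc 2 q)),
            l ^ m * (|∫ ω, ξ i ω ^ m ∂P| / m.factorial) := by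
        refine sum_le_sum_of_subset_of_nonneg ?_ fun m _ _ => by positivity
        intro m hm
        simp only [mem_range, mem_insert, mem_Icc] at *
        omega
      refine hsub.trans ?_
      rw [sum_insert (by simp), sum_insert (by simp)]
      simp only [pow_zero, pow_one, h0 i]
      simpa using hq i
    gcongr

lemma sum_Icc_two_pow_le {x : ℝ} (h0 : 0 ≤ x) (h1 : x ≤ 1 / 2) (q : ℕ) :
    ∑ m ∈ Finset.Icc 2 q, x ^ m ≤ 2 * x ^ 2 := by
  have h := geom_sum_Ico_le_of_lt_one (m := 2) (n := q + 1) h0 (by linarith)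
  have h2 : x ^ 2 / (1 - x) ≤ 2 * x ^ 2 := by
    rw [div_le_iff₀ (by linarith)]
    nlinarith [sq_nonneg x]
  exact (le_of_eq (by rfl)).trans (h.trans h2)

lemma sqrt_le_exp {w : ℝ} (hw : 0 ≤ w) : √w ≤ Real.exp w := by
  have h1 := Real.add_one_le_exp w
  have h2 : √w ≤ 1 + w := by
    rw [Real.sqrt_le_left (by linarith)]
    nlinarith
  linarith

lemma rpow_div_sqrt_pow_le {α : ℝ} (hα0 : 0 < α) (hα2 : α ≤ 2) {m q N : ℕ} (hm : 2 ≤ m)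
    (hmq : m ≤ q) (hN : 0 < N) :
    (((q : ℝ) / m) ^ (1 - 1 / α) / √N) ^ m ≤ (q / N : ℝ) * Real.exp (q / N) := by
  have hm0 : (0 : ℝ) < m := by positivity
  have hmq' : (m : ℝ) ≤ q := by exact_mod_cast hmq
  have hN0 : (0 : ℝ) < N := by positivity
  set w : ℝ := (q : ℝ) / N / m with hw
  have hw0 : 0 ≤ w := by positivity
  have h1 : ((q : ℝ) / m) ^ (1 - 1 / α) / √N ≤ √w := by
    have : ((q : ℝ) / m) ^ (1 - 1 / α) ≤ √((q : ℝ) / m) := by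
      rw [Real.sqrt_eq_rpow]
      apply Real.rpow_le_rpow_of_exponent_le
      · rwa [le_div_iff₀ hm0, one_mul]
      · have : 1 / 2 ≤ 1 / α := one_div_le_one_div_of_le hα0 hα2
        linarith
    calc _ ≤ √((q : ℝ) / m) / √N := by gcongr
      _ = √w := by
        rw [← Real.sqrt_div (by positivity), hw]
        congr 1
        field_simp
  obtain ⟨k, rfl⟩ := Nat.exists_eq_add_of_le hm
  calc _ ≤ (√w) ^ (2 + k) := by gcongr
    _ = w * (√w) ^ k := by rw [pow_add, Real.sq_sqrt hw0]
    _ ≤ (q / N : ℝ) * Real.exp w ^ k := by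
      gcongr
      · rw [hw]
        apply div_le_self (by positivity)
        exact_mod_cast (by omega : 1 ≤ 2 + k)
      · exact sqrt_le_exp hw0
    _ ≤ _ := by
      rw [← Real.exp_nat_mul]
      gcongr
      calc (k : ℝ) * w ≤ ((2 + k : ℕ) : ℝ) * w := by
            gcongr; linarith
        _ = _ := by rw [hw]; field_simp

lemma pow_le_factorial_mul_exp (m : ℕ) : (m : ℝ) ^ m ≤ m.factorial * Real.exp 1 ^ m := by
  have h := Real.pow_div_factorial_le_exp (x := (m : ℝ)) (by positivity) m
  rw [div_le_iff₀ (by positivity)] at h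
  rw [← Real.exp_nat_mul, mul_one]
  linarith

/-- Uniform sub-Weibull moment bound for normalized sums. -/
lemma moment_normalized_sum_le {Ω ι : Type*} [MeasurableSpace Ω] {P : Measure Ω}
    [IsProbabilityMeasure P] (ξ : ι → Ω → ℝ) (hmeas : ∀ i (m : ℕ), MemLp (ξ i) m P)
    (hind : ∀ (s : Finset ι) (i : ι), i ∉ s →
      ProbabilityTheory.IndepFun (fun ω => ∑ k ∈ s, ξ k ω) (ξ i) P)
    (h0 : ∀ i, ∫ ω, ξ i ω ∂P = 0) {α D : ℝ} (hα0 : 0 < α) (hα2 : α ≤ 2) (hD : 0 < D)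
    (hM : ∀ i (m : ℕ), 1 ≤ m → |∫ ω, ξ i ω ^ m ∂P| ≤ 2 * (D * (m : ℝ) ^ (1 / α)) ^ m)
    (I : Finset ι) (hI : 0 < I.card) {q : ℕ} (hq : 1 ≤ q) :
    |∫ ω, ((∑ k ∈ I, ξ k ω) / √(I.card)) ^ q ∂P| ≤
      (2 * D * Real.exp 1 ^ 3 * (q : ℝ) ^ (1 / α)) ^ q := by
  set N := I.card with hN
  have hN0 : (0 : ℝ) < N := by positivity
  have hq0 : (0 : ℝ) < q := by positivity
  set e := Real.exp 1 with he
  have he0 : 0 < e := Real.exp_pos 1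
  set v : ℝ := q / N with hv
  have hv0 : 0 < v := by positivity
  set l : ℝ := (q : ℝ) ^ (1 - 1 / α) / (2 * D * e * √N) with hl
  have hl0 : 0 < l := by positivity
  have key := abs_moment_sum_le ξ hmeas hind h0 (g := v * Real.exp v) hl0 (by positivity) q
    (by
      intro i
      have hb : ∀ m ∈ Finset.Icc 2 q, l ^ m * (|∫ ω, ξ i ω ^ m ∂P| / m.factorial) ≤
          2 * (v * Real.exp v) * (1 / 2) ^ m := by
        intro m hm
        rw [Finset.mem_Icc] at hm
        have hm0 : (0 : ℝ) < m := by exact_mod_cast (by omega : 0 < m)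
        have h1 := hM i m (by omega)
        have h2 := pow_le_factorial_mul_exp m
        have h3 := rpow_div_sqrt_pow_le hα0 hα2 hm.1 hm.2 hI
        have h4 : |∫ ω, ξ i ω ^ m ∂P| / m.factorial ≤
            2 * (D * (m : ℝ) ^ (1 / α) * e / m) ^ m := by
          rw [div_le_iff₀ (by positivity)]
          refine h1.trans ?_
          rw [div_pow, mul_pow _ e, mul_assoc 2, mul_div_assoc, mul_assoc]
          gcongr 2 * ?_
          refine le_mul_of_one_le_right (by positivity) ?_
          rw [div_mul_eq_mul_div, le_div_iff₀ (by positivity)]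
          linarith
        calc _ ≤ l ^ m * (2 * (D * (m : ℝ) ^ (1 / α) * e / m) ^ m) := by gcongr
          _ = 2 * (((q : ℝ) / m) ^ (1 - 1 / α) / √N) ^ m * (1 / 2) ^ m := by
            rw [mul_left_comm, ← mul_pow, mul_assoc 2 (_ ^ m) (_ ^ m), ← mul_pow]
            congr 2
            rw [hl, Real.div_rpow hq0.le hm0.le, Real.rpow_sub hm0, Real.rpow_one]
            field_simp
          _ ≤ _ := by gcongr
      refine (Finset.sum_le_sum hb).trans ?_
      rw [← Finset.mul_sum]
      have := sum_Icc_two_pow_le (x := 1 / 2) (by norm_num) le_rfl q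
      have h5 : 0 < v * Real.exp v := by positivity
      nlinarith) I q le_rfl
  have hG : (1 + v * Real.exp v) ^ N ≤ e ^ (2 * q) := by
    have h1 : 1 + v * Real.exp v ≤ Real.exp (2 * v) := by
      have := Real.add_one_le_exp v
      have h2 : 1 ≤ Real.exp v := Real.one_le_exp hv0.le
      rw [two_mul, Real.exp_add]
      nlinarith
    calc _ ≤ Real.exp (2 * v) ^ N := by gcongr
      _ = _ := by
        rw [← Real.exp_nat_mul, he, ← Real.exp_nat_mul]
        congr 1
        rw [hv]; push_cast; field_simp
  simp_rw [div_pow]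
  rw [integral_div, abs_div, abs_of_nonneg (a := (√(N : ℝ)) ^ q) (by positivity),
    div_le_iff₀ (by positivity)]
  refine key.trans ?_
  have hf : (q.factorial : ℝ) ≤ (q : ℝ) ^ q := by exact_mod_cast Nat.factorial_le_pow q
  calc _ ≤ (q : ℝ) ^ q * l⁻¹ ^ q * e ^ (2 * q) := by gcongr
    _ = _ := by
      rw [pow_mul, ← mul_pow, ← mul_pow, ← mul_pow]
      congr 1
      rw [hl, Real.rpow_sub hq0, Real.rpow_one]
      field_simp

/-- Gaussian-type moment bound for normalized sums, for moment orders small compared to the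
number of summands. -/
lemma even_moment_normalized_sum_le {Ω ι : Type*} [MeasurableSpace Ω] {P : Measure Ω}
    [IsProbabilityMeasure P] (ξ : ι → Ω → ℝ) (hmeas : ∀ i (m : ℕ), MemLp (ξ i) m P)
    (hind : ∀ (s : Finset ι) (i : ι), i ∉ s →
      ProbabilityTheory.IndepFun (fun ω => ∑ k ∈ s, ξ k ω) (ξ i) P)
    (h0 : ∀ i, ∫ ω, ξ i ω ∂P = 0) {α D : ℝ} (hα0 : 0 < α) (hD : 0 < D)
    (hM : ∀ i (m : ℕ), 1 ≤ m → |∫ ω, ξ i ω ^ m ∂P| ≤ 2 * (D * (m : ℝ) ^ (1 / α)) ^ m)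
    (I : Finset ι) (hI : 0 < I.card) {l : ℕ} (hl : 1 ≤ l) {B : ℝ} (hB : 1 ≤ B)
    (hlB : ((2 * l : ℕ) : ℝ) ^ (1 / α) * √((2 * l : ℕ) / I.card) ≤ B) :
    ∫ ω, ((∑ k ∈ I, ξ k ω) / √(I.card)) ^ (2 * l) ∂P ≤
      l.factorial * ((2 * D * Real.exp (2 / α) * B * Real.exp 1) ^ 2) ^ l := by
  set N := I.card with hN
  have hN0 : (0 : ℝ) < N := by positivity
  set q := 2 * l with hqdef
  have hq1 : 1 ≤ q := by omega
  have hq0 : (0 : ℝ) < q := by positivity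
  set e := Real.exp 1 with he
  have he0 : 0 < e := Real.exp_pos 1
  set v : ℝ := q / N with hv
  have hv0 : 0 < v := by positivity
  set b : ℝ := 2 * D * Real.exp (2 / α) * B with hbdef
  have hb0 : 0 < b := by positivity
  set x : ℝ := √v / b with hx
  have hx0 : 0 < x := by positivity
  have key := abs_moment_sum_le ξ hmeas hind h0 (g := v) hx0 (by positivity) q
    (by
      intro i
      have hb : ∀ m ∈ Finset.Icc 2 q, x ^ m * (|∫ ω, ξ i ω ^ m ∂P| / m.factorial) ≤
          2 * v * (1 / 2) ^ m := by
        intro m hm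
        rw [Finset.mem_Icc] at hm
        have hm0 : (0 : ℝ) < m := by exact_mod_cast (by omega : 0 < m)
        have h1 := hM i m (by omega)
        have hfac : (1 : ℝ) ≤ m.factorial := by exact_mod_cast Nat.succ_le_of_lt m.factorial_pos
        have h4 : |∫ ω, ξ i ω ^ m ∂P| / m.factorial ≤ 2 * (D * (m : ℝ) ^ (1 / α)) ^ m :=
          (div_le_self (abs_nonneg _) hfac).trans h1
        have h5 : ((m : ℝ) ^ (1 / α) * √v) ^ m ≤ v * (Real.exp (2 / α) * B) ^ m := by
          obtain ⟨k, rfl⟩ := Nat.exists_eq_add_of_le hm.1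
          have h6 : (((2 + k : ℕ) : ℝ) ^ (1 / α)) ^ 2 ≤ Real.exp (2 / α) ^ (2 + k) := by
            have h8 : ((2 + k : ℕ) : ℝ) ≤ Real.exp ((2 + k : ℕ) : ℝ) := by
              linarith [Real.add_one_le_exp ((2 + k : ℕ) : ℝ)]
            calc _ ≤ (Real.exp ((2 + k : ℕ) : ℝ) ^ (1 / α)) ^ 2 := by gcongr
              _ = _ := by
                rw [← Real.exp_mul, ← Real.exp_nat_mul, ← Real.exp_nat_mul]
                congr 1
                push_cast; ring
          have h7 : ((2 + k : ℕ) : ℝ) ^ (1 / α) * √v ≤ B := by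
            refine le_trans ?_ hlB
            gcongr
            exact_mod_cast hm.2
          calc _ = v * ((((2 + k : ℕ) : ℝ) ^ (1 / α)) ^ 2 *
                (((2 + k : ℕ) : ℝ) ^ (1 / α) * √v) ^ k) := by
                rw [pow_add, mul_pow _ (√v) 2, Real.sq_sqrt hv0.le]; ring
            _ ≤ v * (Real.exp (2 / α) ^ (2 + k) * B ^ k) := by gcongr
            _ ≤ v * (Real.exp (2 / α) ^ (2 + k) * B ^ (2 + k)) := by
                gcongr
                omega
            _ = _ := by rw [mul_pow]
        calc _ ≤ x ^ m * (2 * (D * (m : ℝ) ^ (1 / α)) ^ m) := by gcongr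
          _ = 2 * ((m : ℝ) ^ (1 / α) * √v) ^ m * (D / b) ^ m := by
            rw [mul_left_comm, ← mul_pow, mul_assoc 2 (_ ^ m) (_ ^ m), ← mul_pow]
            congr 2
            rw [hx]; ring
          _ ≤ 2 * (v * (Real.exp (2 / α) * B) ^ m) * (D / b) ^ m := by gcongr
          _ = _ := by
            have h9 : Real.exp (2 / α) * B * (D / b) = 1 / 2 := by rw [hbdef]; field_simp
            rw [← h9, mul_pow _ (D / b)]
            ring
      refine (Finset.sum_le_sum hb).trans ?_
      rw [← Finset.mul_sum]
      have := sum_Icc_two_pow_le (x := 1 / 2) (by norm_num) le_rfl q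
      nlinarith) I q le_rfl
  have hG : (1 + v) ^ N ≤ e ^ q := by
    calc _ ≤ Real.exp v ^ N := by
          gcongr; linarith [Real.add_one_le_exp v]
      _ = _ := by
        rw [← Real.exp_nat_mul, he, ← Real.exp_nat_mul]
        congr 1
        rw [hv]; field_simp
  refine (le_abs_self _).trans ?_
  simp_rw [div_pow]
  rw [integral_div, abs_div, abs_of_nonneg (a := (√(N : ℝ)) ^ q) (by positivity),
    div_le_iff₀ (by positivity)]
  refine key.trans ?_
  have hf : (q.factorial : ℝ) ≤ (q : ℝ) ^ l * l.factorial := by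
    have := Nat.factorial_two_mul_le l
    exact_mod_cast this
  calc _ ≤ ((q : ℝ) ^ l * l.factorial) * x⁻¹ ^ q * e ^ q := by gcongr
    _ = l.factorial * ((b * e) ^ 2) ^ l * √(N : ℝ) ^ q := by
      have h1 : x⁻¹ ^ q = (b ^ 2 * N / q) ^ l := by
        rw [show x⁻¹ ^ q = (x⁻¹ ^ 2) ^ l from pow_mul _ _ _]
        congr 1
        rw [hx, inv_div, div_pow, Real.sq_sqrt hv0.le, hv]
        field_simp
      have h2 : √(N : ℝ) ^ q = (N : ℝ) ^ l := by
        rw [show √(N : ℝ) ^ q = (√(N : ℝ) ^ 2) ^ l from pow_mul _ _ _, Real.sq_sqrt hN0.le]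
      have h3 : (q : ℝ) ^ l * (b ^ 2 * N / q) ^ l = (b ^ 2 * N) ^ l := by
        rw [← mul_pow, mul_div_cancel₀ _ hq0.ne']
      rw [h1, h2, show e ^ q = (e ^ 2) ^ l from pow_mul _ _ _]
      linear_combination ((l.factorial : ℝ) * (e ^ 2) ^ l) * h3

/-- Moment bound for sums of independent centred variables which are rarely nonzero. -/
lemma moment_thresholded_sum_le {Ω ι : Type*} [MeasurableSpace Ω] {P : Measure Ω}
    [IsProbabilityMeasure P] (ξ : ι → Ω → ℝ) (hmeas : ∀ i (m : ℕ), MemLp (ξ i) m P)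
    (hind : ∀ (s : Finset ι) (i : ι), i ∉ s →
      ProbabilityTheory.IndepFun (fun ω => ∑ k ∈ s, ξ k ω) (ξ i) P)
    (h0 : ∀ i, ∫ ω, ξ i ω ∂P = 0) {C π s r R : ℝ} (hC : 0 < C) (hπ : 0 ≤ π) (hs : 0 < s)
    (hR : 0 < R) {Q : ℕ} (hQ : 1 ≤ Q)
    (hM : ∀ i (m : ℕ), 2 ≤ m → m ≤ Q → |∫ ω, ξ i ω ^ m ∂P| ≤ π * (m.factorial * C ^ m))
    (U : Finset ι) (hU : U.card * π ≤ s) (hr : R * (√(s * Q) + Q) ≤ r) :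
    ∫ ω, ((∑ k ∈ U, ξ k ω) / r) ^ Q ∂P ≤ (4 * C / R) ^ Q := by
  have hQ0 : (0 : ℝ) < Q := by positivity
  have hr0 : 0 < r := lt_of_lt_of_le (by positivity) hr
  set y : ℝ := √(Q / (s + Q)) with hy
  have hy0 : 0 < y := by positivity
  have hy2 : y ^ 2 = Q / (s + Q) := Real.sq_sqrt (by positivity)
  have hy1 : y ≤ 1 := by
    rw [hy, Real.sqrt_le_one]
    rw [div_le_one (by positivity)]; linarith
  set l : ℝ := y / (2 * C) with hl
  have hl0 : 0 < l := by positivity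
  have key := abs_moment_sum_le ξ hmeas hind h0 (g := π * (y ^ 2 / 2)) hl0 (by positivity) Q
    (by
      intro i
      have hb : ∀ m ∈ Finset.Icc 2 Q, l ^ m * (|∫ ω, ξ i ω ^ m ∂P| / m.factorial) ≤
          π * (y / 2) ^ m := by
        intro m hm
        rw [Finset.mem_Icc] at hm
        have h1 : |∫ ω, ξ i ω ^ m ∂P| / m.factorial ≤ π * C ^ m := by
          rw [div_le_iff₀ (by positivity)]
          linarith [hM i m hm.1 hm.2]
        calc _ ≤ l ^ m * (π * C ^ m) := by gcongr
          _ = π * (l * C) ^ m := by rw [mul_pow]; ring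
          _ = _ := by
            congr 2
            rw [hl]; field_simp
      refine (Finset.sum_le_sum hb).trans ?_
      rw [← Finset.mul_sum]
      have := sum_Icc_two_pow_le (x := y / 2) (by positivity) (by linarith) Q
      gcongr
      nlinarith) U Q le_rfl
  have hG : (1 + π * (y ^ 2 / 2)) ^ U.card ≤ 2 ^ Q := by
    have h1 : (1 + π * (y ^ 2 / 2)) ^ U.card ≤ Real.exp (Q / 2) := by
      calc _ ≤ Real.exp (π * (y ^ 2 / 2)) ^ U.card := by
            gcongr; linarith [Real.add_one_le_exp (π * (y ^ 2 / 2))]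
        _ = Real.exp (U.card * π * (y ^ 2 / 2)) := by
            rw [← Real.exp_nat_mul]; congr 1; ring
        _ ≤ _ := by
            apply Real.exp_le_exp.2
            calc U.card * π * (y ^ 2 / 2) ≤ s * (y ^ 2 / 2) := by gcongr
              _ = (Q / 2) * (s / (s + Q)) := by rw [hy2]; ring
              _ ≤ Q / 2 * 1 := by
                gcongr
                rw [div_le_one (by positivity)]; linarith
              _ = _ := by ring
    refine h1.trans ?_
    have h2 : Real.exp (Q / 2) = Real.exp (1 / 2) ^ Q := by
      rw [← Real.exp_nat_mul]; congr 1; ring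
    rw [h2]
    gcongr
    have h3 : Real.exp (1 / 2) ^ 2 < 2 ^ 2 := by
      rw [← Real.exp_nat_mul]
      norm_num
      linarith [Real.exp_one_lt_d9]
    exact (lt_of_pow_lt_pow_left₀ 2 (by norm_num) h3).le
  have hlr : R * Q ≤ l * r * (2 * C) := by
    have h1 : l * r * (2 * C) = y * r := by rw [hl]; field_simp
    rw [h1]
    have h2 : Q ≤ y * (√(s * Q) + Q) := by
      have h3 : √(Q * (s + Q)) ≤ √(s * Q) + Q := by
        rw [Real.sqrt_le_left (by positivity)]
        have := Real.sq_sqrt (show 0 ≤ s * Q by positivity)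
        nlinarith [Real.sqrt_nonneg (s * Q)]
      calc (Q : ℝ) = y * √(Q * (s + Q)) := by
            rw [hy, ← Real.sqrt_mul (by positivity)]
            rw [show (Q : ℝ) / (s + Q) * (Q * (s + Q)) = Q ^ 2 by field_simp]
            rw [Real.sqrt_sq hQ0.le]
        _ ≤ _ := by gcongr
    calc R * Q ≤ R * (y * (√(s * Q) + Q)) := by gcongr
      _ = y * (R * (√(s * Q) + Q)) := by ring
      _ ≤ _ := by gcongr
  refine (le_abs_self _).trans ?_
  simp_rw [div_pow]
  rw [integral_div, abs_div, abs_of_nonneg (a := r ^ Q) (by positivity),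
    div_le_iff₀ (by positivity)]
  refine key.trans ?_
  have hf : (Q.factorial : ℝ) ≤ (Q : ℝ) ^ Q := by exact_mod_cast Nat.factorial_le_pow Q
  calc _ ≤ (Q : ℝ) ^ Q * l⁻¹ ^ Q * 2 ^ Q := by gcongr
    _ = (Q * l⁻¹ * 2) ^ Q := by rw [mul_pow, mul_pow]
    _ ≤ (4 * C / R * r) ^ Q := by
      refine pow_le_pow_left₀ (by positivity) ?_ Q
      rw [div_mul_eq_mul_div, le_div_iff₀ hR]
      calc Q * l⁻¹ * 2 * R = (R * Q) * (2 * l⁻¹) := by ring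
        _ ≤ (l * r * (2 * C)) * (2 * l⁻¹) := by gcongr
        _ = _ := by field_simp; ring
    _ = _ := by rw [mul_pow, div_pow]

/-- The moment and independence properties of noise matrices with independent sub-Weibull
entries that are used in the analysis of the tests. -/
structure SubWeibullNoise {p n : ℕ} (α D : ℝ) (P : Measure (Fin n → Fin p → ℝ)) : Prop where
  isProbabilityMeasure : IsProbabilityMeasure P
  indep : ProbabilityTheory.iIndepFun
    (fun (i : Fin n × Fin p) (E : Fin n → Fin p → ℝ) => E i.1 i.2) P
  memLp : ∀ t j (m : ℕ), MemLp (fun E : Fin n → Fin p → ℝ => E t j) m P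
  mean : ∀ t j, ∫ E, E t j ∂P = 0
  sq : ∀ t j, ∫ E, E t j ^ 2 ∂P = 1
  moment : ∀ t j (m : ℕ), 1 ≤ m → |∫ E, E t j ^ m ∂P| ≤ 2 * (D * (m : ℝ) ^ (1 / α)) ^ m

lemma IsEntrywiseProduct.map_eval {p n : ℕ} {P : Measure (Fin n → Fin p → ℝ)}
    {ν : Fin n → Fin p → Measure ℝ} (h : IsEntrywiseProduct p n P ν)
    (hν : ∀ t j, IsProbabilityMeasure (ν t j)) (t : Fin n) (j : Fin p) :
    P.map (fun E => E t j) = ν t j := by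
  ext s hs
  rw [Measure.map_apply (by fun_prop) hs]
  have h1 := h.2 (fun t' j' => if t' = t ∧ j' = j then s else Set.univ) (by
    intro t' j'; split_ifs <;> simp [hs])
  have h2 : (fun E : Fin n → Fin p → ℝ => E t j) ⁻¹' s =
      {x | ∀ t' j', x t' j' ∈ (fun t' j' => if t' = t ∧ j' = j then s else Set.univ) t' j'} := by
    ext x
    simp only [Set.mem_preimage, Set.mem_ofPred_eq]
    constructor
    · intro hx t' j'
      split_ifs with hc
      · rw [hc.1, hc.2]; exact hx
      · trivial
    · intro hx
      simpa using hx t j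
  rw [h2, h1, Finset.prod_eq_single t, Finset.prod_eq_single j]
  · simp
  · intro b _ hb; simp [hb]
  · simp
  · intro b _ hb; simp [hb]
  · simp

lemma IsEntrywiseProduct.iIndepFun {p n : ℕ} {P : Measure (Fin n → Fin p → ℝ)}
    {ν : Fin n → Fin p → Measure ℝ} (h : IsEntrywiseProduct p n P ν)
    (hν : ∀ t j, IsProbabilityMeasure (ν t j)) :
    ProbabilityTheory.iIndepFun
      (fun (i : Fin n × Fin p) (E : Fin n → Fin p → ℝ) => E i.1 i.2) P := by
  rw [ProbabilityTheory.iIndepFun_iff_measure_inter_preimage_eq_mul]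
  intro S sets hsets
  have h1 := h.2 (fun t j => if (t, j) ∈ S then sets (t, j) else Set.univ) (by
    intro t j; split_ifs with hc
    · exact hsets _ hc
    · simp)
  have h2 : (⋂ i ∈ S, (fun E : Fin n → Fin p → ℝ => E i.1 i.2) ⁻¹' sets i) =
      {x | ∀ t j, x t j ∈ (fun t j => if (t, j) ∈ S then sets (t, j) else Set.univ) t j} := by
    ext x
    simp only [Set.mem_iInter, Set.mem_preimage, Set.mem_ofPred_eq]
    constructor
    · intro hx t j
      split_ifs with hc
      · exact hx _ hc
      · trivial
    · intro hx i hi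
      simpa [hi] using hx i.1 i.2
  rw [h2, h1, ← Finset.prod_product']
  rw [Finset.univ_product_univ, ← Finset.prod_subset (Finset.subset_univ S)]
  · refine Finset.prod_congr rfl fun i hi => ?_
    rw [if_pos hi, ← h.map_eval hν i.1 i.2, Measure.map_apply (by fun_prop) (hsets i hi)]
  · intro i _ hi
    have := hν i.1 i.2
    rw [if_neg hi]; simp

lemma rpow_div_le_exp {α y : ℝ} (hα : 0 < α) (hy : 0 ≤ y) {m : ℕ} (hm : 1 ≤ m) :
    y ^ m ≤ ((1 / α) ^ (1 / α) * (m : ℝ) ^ (1 / α)) ^ m * Real.exp (y ^ α) := by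
  have hm0 : (0 : ℝ) < m := by positivity
  have h1 : y ^ α * (α / m) ≤ Real.exp (y ^ α * (α / m)) := by
    linarith [Real.add_one_le_exp (y ^ α * (α / m))]
  have h2 : y ^ α ≤ (m / α) * Real.exp (y ^ α * (α / m)) := by
    calc y ^ α = (m / α) * (y ^ α * (α / m)) := by field_simp
      _ ≤ _ := by gcongr
  have h3 := Real.rpow_le_rpow (by positivity) h2 (show 0 ≤ (m : ℝ) / α by positivity)
  rw [← Real.rpow_mul hy, Real.mul_rpow (by positivity) (by positivity), ← Real.exp_mul] at h3
  rw [show α * (m / α) = (m : ℝ) by field_simp, Real.rpow_natCast,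
    show y ^ α * (α / m) * (m / α) = y ^ α by field_simp] at h3
  refine h3.trans (le_of_eq ?_)
  congr 1
  rw [← Real.mul_rpow (by positivity) (by positivity), ← Real.rpow_natCast,
    ← Real.rpow_mul (by positivity)]
  congr 1 <;> field_simp

/-- Moments of a sub-Weibull distribution. -/
lemma memG.moments {α K : ℝ} (hα : 0 < α) (hK : 0 < K) {ν : Measure ℝ} (h : memG α K ν) :
    (∀ m : ℕ, MemLp (fun x : ℝ => x) m ν) ∧ (∀ m : ℕ, 1 ≤ m →
      |∫ x, x ^ m ∂ν| ≤ 2 * (K * (1 / α) ^ (1 / α) * (m : ℝ) ^ (1 / α)) ^ m) := by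
  obtain ⟨hp, -, -, -, hexp⟩ := h
  have hmeasE : Measurable fun x : ℝ => Real.exp (|x / K| ^ α) := by
    have : Measurable fun x : ℝ => |x / K| := by fun_prop
    exact (this.pow_const α).exp
  have hint : Integrable (fun x : ℝ => Real.exp (|x / K| ^ α)) ν := by
    refine ⟨hmeasE.aestronglyMeasurable, ?_⟩
    rw [hasFiniteIntegral_iff_ofReal (Filter.Eventually.of_forall fun x => (Real.exp_pos _).le)]
    exact lt_of_le_of_lt hexp (by simp)
  have hle : ∫ x, Real.exp (|x / K| ^ α) ∂ν ≤ 2 := by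
    rw [integral_eq_lintegral_of_nonneg_ae
      (Filter.Eventually.of_forall fun x => (Real.exp_pos _).le) hmeasE.aestronglyMeasurable]
    exact ENNReal.toReal_le_of_le_ofReal (by norm_num) (by simpa using hexp)
  have hpt : ∀ (m : ℕ), 1 ≤ m → ∀ x : ℝ, |x| ^ m ≤
      (K * (1 / α) ^ (1 / α) * (m : ℝ) ^ (1 / α)) ^ m * Real.exp (|x / K| ^ α) := by
    intro m hm x
    have := rpow_div_le_exp hα (abs_nonneg (x / K)) hm
    calc |x| ^ m = K ^ m * |x / K| ^ m := by
          rw [abs_div, abs_of_pos hK, ← mul_pow]; congr 1; field_simp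
      _ ≤ K ^ m * (((1 / α) ^ (1 / α) * (m : ℝ) ^ (1 / α)) ^ m * Real.exp (|x / K| ^ α)) := by
          gcongr
      _ = _ := by rw [← mul_assoc, ← mul_pow]; ring
  have hI : ∀ m : ℕ, 1 ≤ m → Integrable (fun x : ℝ => |x| ^ m) ν := by
    intro m hm
    refine (hint.const_mul ((K * (1 / α) ^ (1 / α) * (m : ℝ) ^ (1 / α)) ^ m)).mono'
      (by fun_prop) (Filter.Eventually.of_forall fun x => ?_)
    rw [Real.norm_of_nonneg (by positivity)]
    exact hpt m hm x
  constructor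
  · intro m
    rcases Nat.eq_zero_or_pos m with rfl | hm
    · simpa using (by fun_prop : AEStronglyMeasurable (fun x : ℝ => x) ν)
    · rw [← integrable_norm_rpow_iff (by fun_prop) (by simpa using hm.ne') (by simp)]
      simpa using hI m hm
  · intro m hm
    calc |∫ x, x ^ m ∂ν| ≤ ∫ x, |x ^ m| ∂ν := abs_integral_le_integral_abs
      _ = ∫ x, |x| ^ m ∂ν := by simp_rw [abs_pow]
      _ ≤ ∫ x, (K * (1 / α) ^ (1 / α) * (m : ℝ) ^ (1 / α)) ^ m * Real.exp (|x / K| ^ α) ∂ν :=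
          integral_mono (hI m hm) (hint.const_mul _) (hpt m hm)
      _ = (K * (1 / α) ^ (1 / α) * (m : ℝ) ^ (1 / α)) ^ m * ∫ x, Real.exp (|x / K| ^ α) ∂ν :=
          integral_const_mul _ _
      _ ≤ (K * (1 / α) ^ (1 / α) * (m : ℝ) ^ (1 / α)) ^ m * 2 := by gcongr
      _ = _ := by ring

lemma subWeibullNoise_of_mem_Gclass {p n : ℕ} {α K : ℝ} (hα : 0 < α) (hK : 0 < K)
    {P : Measure (Fin n → Fin p → ℝ)} (hP : P ∈ Gclass p n α K) :
    SubWeibullNoise α (K * (1 / α) ^ (1 / α)) P := by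
  obtain ⟨ν, hν, hprod⟩ := hP
  have hν1 : ∀ t j, IsProbabilityMeasure (ν t j) := fun t j => (hν t j).1
  have hmap := hprod.map_eval hν1
  have hev : ∀ t j, AEMeasurable (fun E : Fin n → Fin p → ℝ => E t j) P := fun t j =>
    (by fun_prop : Measurable fun E : Fin n → Fin p → ℝ => E t j).aemeasurable
  have hint : ∀ t j (m : ℕ), ∫ E, E t j ^ m ∂P = ∫ x, x ^ m ∂(ν t j) := by
    intro t j m
    rw [← hmap t j, integral_map (hev t j) (by fun_prop)]
  refine ⟨hprod.1, hprod.iIndepFun hν1, fun t j m => ?_, fun t j => ?_, fun t j => ?_,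
    fun t j m hm => ?_⟩
  · have := ((hν t j).moments hα hK).1 m
    rw [← hmap t j] at this
    exact (memLp_map_measure_iff (by fun_prop) (hev t j)).1 this
  · have := hint t j 1
    simp only [pow_one] at this
    rw [this]; exact (hν t j).2.2.1
  · rw [hint, integral_eq_lintegral_of_nonneg_ae
      (Filter.Eventually.of_forall fun x => sq_nonneg x) (by fun_prop), (hν t j).2.2.2.1]
    simp
  · rw [hint]
    exact ((hν t j).moments hα hK).2 m hm

lemma SubWeibullNoise.indepFun_of_disjoint {p n : ℕ} {α D : ℝ}
    {P : Measure (Fin n → Fin p → ℝ)} (hP : SubWeibullNoise α D P)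
    {A B : Finset (Fin n × Fin p)} (hAB : Disjoint A B) {F G : (Fin n → Fin p → ℝ) → ℝ}
    (hF : Measurable F) (hG : Measurable G)
    (hFA : ∀ E E' : Fin n → Fin p → ℝ, (∀ i ∈ A, E i.1 i.2 = E' i.1 i.2) → F E = F E')
    (hGB : ∀ E E' : Fin n → Fin p → ℝ, (∀ i ∈ B, E i.1 i.2 = E' i.1 i.2) → G E = G E') :
    ProbabilityTheory.IndepFun F G P := by
  let ext (A : Finset (Fin n × Fin p)) (v : A → ℝ) : Fin n → Fin p → ℝ :=
    fun t j => if h : (t, j) ∈ A then v ⟨(t, j), h⟩ else 0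
  have hext : ∀ A, Measurable (ext A) := by
    intro A
    refine measurable_pi_lambda _ fun t => measurable_pi_lambda _ fun j => ?_
    by_cases h : (t, j) ∈ A
    · simpa [ext, h] using measurable_pi_apply _
    · simp [ext, h]
  have h := hP.indep.indepFun_finset A B hAB (fun i => by fun_prop)
  have h2 := h.comp (hF.comp (hext A)) (hG.comp (hext B))
  have e1 : (F ∘ ext A) ∘ (fun (E : Fin n → Fin p → ℝ) (i : A) => E i.1.1 i.1.2) = F := by
    funext E
    refine hFA _ _ fun i hi => ?_
    simp [ext, hi]
  have e2 : (G ∘ ext B) ∘ (fun (E : Fin n → Fin p → ℝ) (i : B) => E i.1.1 i.1.2) = G := by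
    funext E
    refine hGB _ _ fun i hi => ?_
    simp [ext, hi]
  rwa [e1, e2] at h2

/-- Functions of distinct columns satisfy the independence assumption of the moment bounds. -/
lemma SubWeibullNoise.indepFun_sum_coord {p n : ℕ} {α D : ℝ}
    {P : Measure (Fin n → Fin p → ℝ)} (hP : SubWeibullNoise α D P)
    {F : Fin p → (Fin n → Fin p → ℝ) → ℝ} (hF : ∀ j, Measurable (F j))
    (hFj : ∀ j (E E' : Fin n → Fin p → ℝ), (∀ t, E t j = E' t j) → F j E = F j E')
    (S : Finset (Fin p)) (i : Fin p) (hi : i ∉ S) :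
    ProbabilityTheory.IndepFun (fun E => ∑ j ∈ S, F j E) (F i) P := by
  refine hP.indepFun_of_disjoint (A := Finset.univ ×ˢ S) (B := Finset.univ ×ˢ {i}) ?_
    (Finset.measurable_fun_sum _ fun j _ => hF j) (hF i) ?_ ?_
  · rw [Finset.disjoint_left]
    rintro ⟨t, j⟩ h1 h2
    simp only [Finset.mem_product, Finset.mem_univ, true_and, Finset.mem_singleton] at h1 h2
    exact hi (h2 ▸ h1)
  · intro E E' h
    refine Finset.sum_congr rfl fun j hj => hFj j _ _ fun t => h (t, j) (by simp [hj])
  · intro E E' h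
    exact hFj i _ _ fun t => h (t, i) (by simp)

/-- Normalized signed sum of the noise over the columns in `I`. -/
noncomputable def signedMean {p n : ℕ} (σ : Fin n → ℝ) (I : Finset (Fin n))
    (E : Fin n → Fin p → ℝ) (j : Fin p) : ℝ :=
  (∑ i ∈ I, σ i * E i j) / √(I.card)

lemma measurable_signedMean {p n : ℕ} (σ : Fin n → ℝ) (I : Finset (Fin n)) (j : Fin p) :
    Measurable fun E : Fin n → Fin p → ℝ => signedMean σ I E j := by
  unfold signedMean; fun_prop

lemma signedMean_congr {p n : ℕ} {σ : Fin n → ℝ} {I : Finset (Fin n)} {j : Fin p}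
    {E E' : Fin n → Fin p → ℝ} (h : ∀ t ∈ I, E t j = E' t j) :
    signedMean σ I E j = signedMean σ I E' j := by
  unfold signedMean
  rw [Finset.sum_congr rfl fun t ht => by rw [h t ht]]

section signedMean

variable {p n : ℕ} {α D : ℝ} {P : Measure (Fin n → Fin p → ℝ)} {σ : Fin n → ℝ}
  {I : Finset (Fin n)} (j : Fin p)

lemma SubWeibullNoise.memLp_mul (hP : SubWeibullNoise α D P) (i : Fin n) (m : ℕ) :
    MemLp (fun E : Fin n → Fin p → ℝ => σ i * E i j) m P :=
  (hP.memLp i j m).const_mul _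

lemma SubWeibullNoise.memLp_signedMean (hP : SubWeibullNoise α D P) (m : ℕ) :
    MemLp (fun E : Fin n → Fin p → ℝ => signedMean σ I E j) m P := by
  have := (memLp_finsetSum I fun i _ => hP.memLp_mul (σ := σ) j i m).mul_const (√(I.card))⁻¹
  simpa [signedMean, div_eq_mul_inv] using this

lemma SubWeibullNoise.integrable_signedMean_pow (hP : SubWeibullNoise α D P) (m : ℕ) :
    Integrable (fun E : Fin n → Fin p → ℝ => signedMean σ I E j ^ m) P := by
  have := hP.isProbabilityMeasure
  have h := (hP.memLp_signedMean (σ := σ) (I := I) j m).integrable_norm_pow'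
  refine h.mono' ((measurable_signedMean σ I j).pow_const m).aestronglyMeasurable ?_
  exact Filter.Eventually.of_forall fun E => by simp

lemma SubWeibullNoise.indepFun_sum_mul (hP : SubWeibullNoise α D P) (s : Finset (Fin n))
    (i : Fin n) (hi : i ∉ s) :
    ProbabilityTheory.IndepFun (fun E : Fin n → Fin p → ℝ => ∑ k ∈ s, σ k * E k j)
      (fun E => σ i * E i j) P := by
  refine hP.indepFun_of_disjoint (A := s ×ˢ {j}) (B := {i} ×ˢ {j}) ?_ (by fun_prop)
    (by fun_prop) ?_ ?_
  · rw [Finset.disjoint_left]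
    rintro ⟨t, j⟩ h1 h2
    simp only [Finset.mem_product, Finset.mem_singleton] at h1 h2
    exact hi (h2.1 ▸ h1.1)
  · intro E E' h
    refine Finset.sum_congr rfl fun k hk => by rw [h (k, j) (by simp [hk])]
  · intro E E' h
    rw [h (i, j) (by simp)]

lemma SubWeibullNoise.mean_mul (hP : SubWeibullNoise α D P) (i : Fin n) :
    ∫ E : Fin n → Fin p → ℝ, σ i * E i j ∂P = 0 := by
  rw [integral_const_mul, hP.mean, mul_zero]

lemma SubWeibullNoise.moment_mul (hP : SubWeibullNoise α D P) (hσ : ∀ i, |σ i| = 1) (i : Fin n)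
    (m : ℕ) (hm : 1 ≤ m) :
    |∫ E : Fin n → Fin p → ℝ, (σ i * E i j) ^ m ∂P| ≤ 2 * (D * (m : ℝ) ^ (1 / α)) ^ m := by
  have h1 : ∀ E : Fin n → Fin p → ℝ, (σ i * E i j) ^ m = σ i ^ m * E i j ^ m :=
    fun E => mul_pow _ _ _
  simp_rw [h1]
  rw [integral_const_mul, abs_mul, abs_pow, hσ, one_pow, one_mul]
  exact hP.moment i j m hm

lemma SubWeibullNoise.moment_signedMean (hP : SubWeibullNoise α D P) (hσ : ∀ i, |σ i| = 1)
    (hα0 : 0 < α) (hα2 : α ≤ 2) (hD : 0 < D) (hI : 0 < I.card) {q : ℕ} (hq : 1 ≤ q) :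
    |∫ E, signedMean σ I E j ^ q ∂P| ≤ (2 * D * Real.exp 1 ^ 3 * (q : ℝ) ^ (1 / α)) ^ q := by
  have := hP.isProbabilityMeasure
  exact moment_normalized_sum_le (fun i (E : Fin n → Fin p → ℝ) => σ i * E i j)
    (hP.memLp_mul j) (hP.indepFun_sum_mul j) (hP.mean_mul j) hα0 hα2 hD (hP.moment_mul j hσ)
    I hI hq

lemma SubWeibullNoise.even_moment_signedMean (hP : SubWeibullNoise α D P) (hσ : ∀ i, |σ i| = 1)
    (hα0 : 0 < α) (hD : 0 < D) (hI : 0 < I.card) {l : ℕ} (hl : 1 ≤ l) {B : ℝ} (hB : 1 ≤ B)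
    (hlB : ((2 * l : ℕ) : ℝ) ^ (1 / α) * √((2 * l : ℕ) / I.card) ≤ B) :
    ∫ E, signedMean σ I E j ^ (2 * l) ∂P ≤
      l.factorial * ((2 * D * Real.exp (2 / α) * B * Real.exp 1) ^ 2) ^ l := by
  have := hP.isProbabilityMeasure
  exact even_moment_normalized_sum_le (fun i (E : Fin n → Fin p → ℝ) => σ i * E i j)
    (hP.memLp_mul j) (hP.indepFun_sum_mul j) (hP.mean_mul j) hα0 hD (hP.moment_mul j hσ)
    I hI hl hB hlB

lemma SubWeibullNoise.sq_signedMean (hP : SubWeibullNoise α D P) (hσ : ∀ i, |σ i| = 1)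
    (hI : 0 < I.card) : ∫ E, signedMean σ I E j ^ 2 ∂P = 1 := by
  have := hP.isProbabilityMeasure
  have hL : ∀ (s : Finset (Fin n)) (m : ℕ),
      MemLp (fun E : Fin n → Fin p → ℝ => ∑ k ∈ s, σ k * E k j) m P := fun s m =>
    memLp_finsetSum s fun i _ => hP.memLp_mul j i m
  have key : ∀ s : Finset (Fin n),
      ∫ E : Fin n → Fin p → ℝ, (∑ k ∈ s, σ k * E k j) ^ 2 ∂P = s.card := by
    intro s
    induction s using Finset.induction_on with
    | empty => simp
    | insert i s hi ih =>
      have h1 : ∀ E : Fin n → Fin p → ℝ, (∑ k ∈ insert i s, σ k * E k j) ^ 2 =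
          (σ i * E i j) ^ 2 + 2 * ((∑ k ∈ s, σ k * E k j) * (σ i * E i j)) +
            (∑ k ∈ s, σ k * E k j) ^ 2 := by
        intro E; rw [Finset.sum_insert hi]; ring
      simp_rw [h1]
      have i1 : Integrable (fun E : Fin n → Fin p → ℝ => (σ i * E i j) ^ 2) P :=
        (by exact_mod_cast hP.memLp_mul j i 2 : MemLp _ 2 P).integrable_sq
      have i2 : Integrable (fun E : Fin n → Fin p → ℝ => (∑ k ∈ s, σ k * E k j) ^ 2) P :=
        (by exact_mod_cast hL s 2 : MemLp _ 2 P).integrable_sq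
      have i3 : Integrable (fun E : Fin n → Fin p → ℝ =>
          (∑ k ∈ s, σ k * E k j) * (σ i * E i j)) P :=
        (by exact_mod_cast hL s 2 : MemLp _ 2 P).integrable_mul
          (by exact_mod_cast hP.memLp_mul j i 2 : MemLp _ 2 P)
      have i4 : Integrable (fun E : Fin n → Fin p → ℝ => (σ i * E i j) ^ 2 +
          2 * ((∑ k ∈ s, σ k * E k j) * (σ i * E i j))) P := i1.add (i3.const_mul 2)
      rw [integral_add i4 i2, integral_add i1 (i3.const_mul 2), ih,
        integral_const_mul,
        (hP.indepFun_sum_mul j s i hi).integral_fun_mul_eq_mul_integral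
          (hL s 1).aestronglyMeasurable (hP.memLp_mul j i 1).aestronglyMeasurable,
        hP.mean_mul, Finset.card_insert_of_notMem hi]
      simp_rw [mul_pow]
      rw [integral_const_mul, hP.sq, ← sq_abs, hσ]
      push_cast; ring
  unfold signedMean
  simp_rw [div_pow]
  rw [integral_div, key, Real.sq_sqrt (by positivity)]
  field_simp

end signedMean

/-- Indicator of `a ≤ |x|`. -/
noncomputable def thr (a x : ℝ) : ℝ := if a ≤ |x| then 1 else 0

lemma measurable_thr (a : ℝ) : Measurable (thr a) :=
  Measurable.ite (measurableSet_le (by fun_prop) (by fun_prop)) (by fun_prop) (by fun_prop)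

lemma thr_nonneg (a x : ℝ) : 0 ≤ thr a x := by unfold thr; split_ifs <;> norm_num

lemma thr_le_one (a x : ℝ) : thr a x ≤ 1 := by unfold thr; split_ifs <;> norm_num

lemma thr_pow (a x : ℝ) {m : ℕ} (hm : 1 ≤ m) : thr a x ^ m = thr a x := by
  have : m ≠ 0 := by omega
  unfold thr; split_ifs <;> simp [this]

lemma thr_le_pow {a b x : ℝ} (hb : 0 < b) (hba : b ≤ a) {q : ℕ} (hq : Even q) :
    thr a x ≤ (x / b) ^ q := by
  unfold thr
  split_ifs with h
  · rw [← hq.pow_abs, abs_div, abs_of_pos hb]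
    exact one_le_pow₀ ((one_le_div hb).2 (hba.trans h))
  · exact hq.pow_nonneg _

lemma sq_mul_thr_le {a b x : ℝ} (hb : 0 < b) (hba : b ≤ a) {q : ℕ} (hq : Even q) (hq2 : 2 ≤ q) :
    x ^ 2 * thr a x ≤ b ^ 2 * (x / b) ^ q := by
  unfold thr
  split_ifs with h
  · have h1 : 1 ≤ |x / b| := by
      rw [abs_div, abs_of_pos hb]
      exact (one_le_div hb).2 (hba.trans h)
    have h2 := pow_le_pow_right₀ h1 hq2
    rw [hq.pow_abs, sq_abs] at h2
    calc x ^ 2 * 1 = b ^ 2 * (x / b) ^ 2 := by field_simp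
      _ ≤ _ := by gcongr
  · rw [mul_zero]
    exact mul_nonneg (sq_nonneg _) (hq.pow_nonneg _)

section thr

variable {p n : ℕ} {α D : ℝ} {P : Measure (Fin n → Fin p → ℝ)} {σ : Fin n → ℝ}
  {I : Finset (Fin n)} (j : Fin p) {C₁ L : ℝ}

lemma SubWeibullNoise.tail_moment_le (hP : SubWeibullNoise α D P) (hσ : ∀ i, |σ i| = 1)
    (hα0 : 0 < α) (hα2 : α ≤ 2) (hD : 0 < D) (hI : 0 < I.card) (hL : 1 ≤ L) (hC₁ : 0 < C₁)
    (hDC : Real.exp 1 * (2 * D * Real.exp 1 ^ 3) * 4 ^ (1 / α) ≤ C₁) :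
    ∫ E, (signedMean σ I E j / (C₁ * L ^ (1 / α))) ^ (2 * ⌈L⌉₊) ∂P ≤ Real.exp (-L) := by
  have hc : 0 < ⌈L⌉₊ := Nat.ceil_pos.2 (by linarith)
  set q := 2 * ⌈L⌉₊ with hq
  have hL0 : 0 < L := by linarith
  have hqL : (q : ℝ) ≤ 4 * L := by
    have := (Nat.ceil_lt_add_one hL0.le).le
    rw [hq]; push_cast; linarith
  have hLq : L ≤ q := by
    have := Nat.le_ceil L
    rw [hq]; push_cast; linarith
  have hb : 0 < C₁ * L ^ (1 / α) := by positivity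
  simp_rw [div_pow]
  rw [integral_div, div_le_iff₀ (by positivity)]
  have h1 := (le_abs_self _).trans
    (hP.moment_signedMean (I := I) j hσ hα0 hα2 hD hI (q := q) (by omega))
  refine h1.trans ?_
  have h2 : 2 * D * Real.exp 1 ^ 3 * (q : ℝ) ^ (1 / α) ≤ Real.exp (-1) * (C₁ * L ^ (1 / α)) := by
    have h3 : (q : ℝ) ^ (1 / α) ≤ 4 ^ (1 / α) * L ^ (1 / α) := by
      rw [← Real.mul_rpow (by norm_num) hL0.le]
      exact Real.rpow_le_rpow (by positivity) hqL (by positivity)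
    calc _ ≤ 2 * D * Real.exp 1 ^ 3 * (4 ^ (1 / α) * L ^ (1 / α)) := by gcongr
      _ = Real.exp (-1) * ((Real.exp 1 * (2 * D * Real.exp 1 ^ 3) * 4 ^ (1 / α)) *
            L ^ (1 / α)) := by
          rw [Real.exp_neg]; field_simp
      _ ≤ _ := by gcongr
  calc _ ≤ (Real.exp (-1) * (C₁ * L ^ (1 / α))) ^ q := by gcongr
    _ = Real.exp (-q) * (C₁ * L ^ (1 / α)) ^ q := by
      rw [mul_pow, ← Real.exp_nat_mul]; simp
    _ ≤ _ := by gcongr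

variable {a : ℝ}

lemma SubWeibullNoise.integral_thr_le (hP : SubWeibullNoise α D P) (hσ : ∀ i, |σ i| = 1)
    (hα0 : 0 < α) (hα2 : α ≤ 2) (hD : 0 < D) (hI : 0 < I.card) (hL : 1 ≤ L) (hC₁ : 0 < C₁)
    (hDC : Real.exp 1 * (2 * D * Real.exp 1 ^ 3) * 4 ^ (1 / α) ≤ C₁)
    (ha : C₁ * L ^ (1 / α) ≤ a) :
    ∫ E, thr a (signedMean σ I E j) ∂P ≤ Real.exp (-L) := by
  refine le_trans ?_ (hP.tail_moment_le j hσ hα0 hα2 hD hI hL hC₁ hDC)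
  have hb : 0 < C₁ * L ^ (1 / α) := by positivity
  refine integral_mono_of_nonneg (Filter.Eventually.of_forall fun E => thr_nonneg _ _) ?_
    (Filter.Eventually.of_forall fun E => thr_le_pow hb ha (even_two_mul _))
  simp_rw [div_pow]
  exact (hP.integrable_signedMean_pow j _).div_const _

lemma SubWeibullNoise.integral_sq_mul_thr_le (hP : SubWeibullNoise α D P) (hσ : ∀ i, |σ i| = 1)
    (hα0 : 0 < α) (hα2 : α ≤ 2) (hD : 0 < D) (hI : 0 < I.card) (hL : 1 ≤ L) (hC₁ : 0 < C₁)
    (hDC : Real.exp 1 * (2 * D * Real.exp 1 ^ 3) * 4 ^ (1 / α) ≤ C₁)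
    (ha : C₁ * L ^ (1 / α) ≤ a) :
    ∫ E, signedMean σ I E j ^ 2 * thr a (signedMean σ I E j) ∂P ≤
      (C₁ * L ^ (1 / α)) ^ 2 * Real.exp (-L) := by
  have hb : 0 < C₁ * L ^ (1 / α) := by positivity
  have hc : 0 < ⌈L⌉₊ := Nat.ceil_pos.2 (by linarith)
  refine le_trans ?_ (mul_le_mul_of_nonneg_left
    (hP.tail_moment_le (I := I) j hσ hα0 hα2 hD hI hL hC₁ hDC) (sq_nonneg _))
  rw [← integral_const_mul]
  refine integral_mono_of_nonneg
    (Filter.Eventually.of_forall fun E => mul_nonneg (sq_nonneg _) (thr_nonneg _ _)) ?_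
    (Filter.Eventually.of_forall fun E => sq_mul_thr_le hb ha (even_two_mul _) (by omega))
  simp_rw [div_pow]
  exact ((hP.integrable_signedMean_pow j _).div_const _).const_mul _

end thr

lemma abs_sq_sub_one_pow_le (z : ℝ) (m : ℕ) : |(z ^ 2 - 1) ^ m| ≤ z ^ (2 * m) + 1 := by
  rw [abs_pow]
  have h2 : 0 ≤ (z ^ 2) ^ m := by positivity
  rcases le_total (z ^ 2) 1 with h | h
  · have h1 : |z ^ 2 - 1| ^ m ≤ 1 :=
      pow_le_one₀ (abs_nonneg _) (abs_le.2 ⟨by nlinarith [sq_nonneg z], by linarith⟩)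
    rw [pow_mul]; linarith
  · have h1 : |z ^ 2 - 1| ^ m ≤ (z ^ 2) ^ m := by
      gcongr; rw [abs_of_nonneg (by linarith)]; linarith
    rw [pow_mul]; linarith

section thresholded

variable {p n : ℕ} {α D : ℝ} {P : Measure (Fin n → Fin p → ℝ)} {σ : Fin n → ℝ}
  {I₁ I₂ : Finset (Fin n)} {C₁ L a : ℝ}

/-- Contribution of a column to the thresholded statistic. -/
noncomputable def thrTerm (σ : Fin n → ℝ) (I₁ I₂ : Finset (Fin n)) (a : ℝ) (j : Fin p)
    (E : Fin n → Fin p → ℝ) : ℝ :=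
  (signedMean σ I₁ E j ^ 2 - 1) * thr a (signedMean σ I₂ E j)

lemma measurable_thrTerm (j : Fin p) :
    Measurable (thrTerm σ I₁ I₂ a j : (Fin n → Fin p → ℝ) → ℝ) := by
  have h1 := measurable_signedMean (p := p) σ I₁ j
  have h2 := (measurable_thr a).comp (measurable_signedMean (p := p) σ I₂ j)
  exact ((h1.pow_const 2).sub_const 1).mul h2

lemma SubWeibullNoise.integrable_sq_sub_one_pow (hP : SubWeibullNoise α D P) (j : Fin p) (m : ℕ) :
    Integrable (fun E : Fin n → Fin p → ℝ => (signedMean σ I₁ E j ^ 2 - 1) ^ m) P := by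
  have := hP.isProbabilityMeasure
  refine ((hP.integrable_signedMean_pow (σ := σ) (I := I₁) j (2 * m)).add
    (integrable_const 1)).mono' ?_ (Filter.Eventually.of_forall fun E => ?_)
  · exact (((measurable_signedMean σ I₁ j).pow_const 2).sub_const 1).pow_const m
      |>.aestronglyMeasurable
  · exact abs_sq_sub_one_pow_le _ _

lemma SubWeibullNoise.memLp_thrTerm (hP : SubWeibullNoise α D P) (j : Fin p) (m : ℕ) :
    MemLp (thrTerm σ I₁ I₂ a j : (Fin n → Fin p → ℝ) → ℝ) m P := by
  have hM := (measurable_thrTerm (σ := σ) (I₁ := I₁) (I₂ := I₂) (a := a) j).aestronglyMeasurable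
    (μ := P)
  rcases Nat.eq_zero_or_pos m with rfl | hm
  · simpa using hM
  · rw [← integrable_norm_rpow_iff hM (by simpa using hm.ne') (by simp)]
    refine (hP.integrable_sq_sub_one_pow (σ := σ) (I₁ := I₁) j m).norm.mono' ?_
      (Filter.Eventually.of_forall fun E => ?_)
    · simpa [Pi.pow_def] using hM.norm.pow m
    · simp only [thrTerm, norm_mul, norm_pow, Real.norm_eq_abs,
        ENNReal.toReal_natCast, Real.rpow_natCast, abs_abs]
      gcongr
      have h1 := thr_nonneg a (signedMean σ I₂ E j)
      have h2 := thr_le_one a (signedMean σ I₂ E j)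
      rw [abs_of_nonneg h1]
      exact mul_le_of_le_one_right (abs_nonneg _) h2

lemma SubWeibullNoise.integral_thrTerm_pow (hP : SubWeibullNoise α D P) (hI : Disjoint I₁ I₂)
    (j : Fin p) {m : ℕ} (hm : 1 ≤ m) :
    ∫ E, thrTerm σ I₁ I₂ a j E ^ m ∂P =
      (∫ E, (signedMean σ I₁ E j ^ 2 - 1) ^ m ∂P) * ∫ E, thr a (signedMean σ I₂ E j) ∂P := by
  have h1 := (((measurable_signedMean (p := p) σ I₁ j).pow_const 2).sub_const 1).pow_const m
  have h2 := (measurable_thr a).comp (measurable_signedMean (p := p) σ I₂ j)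
  have hind := hP.indepFun_of_disjoint (A := I₁ ×ˢ {j}) (B := I₂ ×ˢ {j})
    (by
      rw [Finset.disjoint_left]
      rintro ⟨t, k⟩ g1 g2
      simp only [Finset.mem_product, Finset.mem_singleton] at g1 g2
      exact Finset.disjoint_left.1 hI g1.1 g2.1) h1 h2
    (by
      intro E E' h
      rw [signedMean_congr fun t ht => h (t, j) (by simp [ht])])
    (by
      intro E E' h
      simp only [Function.comp]
      rw [signedMean_congr fun t ht => h (t, j) (by simp [ht])])
  refine Eq.trans ?_
    (hind.integral_fun_mul_eq_mul_integral h1.aestronglyMeasurable h2.aestronglyMeasurable)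
  congr 1; funext E
  rw [thrTerm, mul_pow, thr_pow _ _ hm]; rfl

/-- Moment bound for the thresholded statistic over a set `U` of signal-free columns. -/
lemma SubWeibullNoise.moment_sum_thrTerm_le (hP : SubWeibullNoise α D P) (hσ : ∀ i, |σ i| = 1)
    (hα0 : 0 < α) (hα2 : α ≤ 2) (hD : 0 < D) (hI : Disjoint I₁ I₂) (hI₁ : 0 < I₁.card)
    (hI₂ : 0 < I₂.card) (hL : 1 ≤ L) (hC₁ : 0 < C₁)
    (hDC : Real.exp 1 * (2 * D * Real.exp 1 ^ 3) * 4 ^ (1 / α) ≤ C₁)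
    (ha : C₁ * L ^ (1 / α) ≤ a) {Q : ℕ} (hQ : 1 ≤ Q) {B : ℝ} (hB : 1 ≤ B)
    (hQB : ((2 * Q : ℕ) : ℝ) ^ (1 / α) * √((2 * Q : ℕ) / I₁.card) ≤ B)
    {s r R : ℝ} (hs : 0 < s) (hR : 0 < R) (hr : R * (√(s * Q) + Q) ≤ r) (U : Finset (Fin p))
    (hU : U.card * Real.exp (-L) ≤ s) :
    ∫ E, ((∑ j ∈ U, thrTerm σ I₁ I₂ a j E) / r) ^ Q ∂P ≤
      (4 * ((2 * D * Real.exp (2 / α) * B * Real.exp 1) ^ 2 + 1) / R) ^ Q := by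
  have := hP.isProbabilityMeasure
  set C := (2 * D * Real.exp (2 / α) * B * Real.exp 1) ^ 2 with hC
  have hC0 : 0 ≤ C := by positivity
  refine moment_thresholded_sum_le (fun j => thrTerm σ I₁ I₂ a j) hP.memLp_thrTerm
    (hP.indepFun_sum_coord (fun j => measurable_thrTerm j) ?_) ?_ (by positivity)
    (Real.exp_pos (-L)).le hs hR hQ ?_ U hU hr
  · intro j E E' h
    unfold thrTerm
    rw [signedMean_congr fun t _ => h t, signedMean_congr (I := I₂) fun t _ => h t]
  · intro j
    have h1 := hP.integral_thrTerm_pow (σ := σ) (a := a) hI j (m := 1) le_rfl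
    simp only [pow_one] at h1
    rw [h1, integral_sub (hP.integrable_signedMean_pow j 2) (integrable_const 1),
      hP.sq_signedMean j hσ hI₁]
    simp
  · intro j m hm hmQ
    rw [hP.integral_thrTerm_pow hI j (by omega), abs_mul,
      abs_of_nonneg (a := ∫ E, thr a (signedMean σ I₂ E j) ∂P)
        (integral_nonneg fun E => thr_nonneg _ _), mul_comm]
    have h1 := hP.integral_thr_le (σ := σ) (I := I₂) j hσ hα0 hα2 hD hI₂ hL hC₁ hDC ha
    have hmB : ((2 * m : ℕ) : ℝ) ^ (1 / α) * √((2 * m : ℕ) / I₁.card) ≤ B := by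
      refine le_trans ?_ hQB
      gcongr
    have h2 := hP.even_moment_signedMean (I := I₁) j hσ hα0 hD hI₁ (l := m) (by omega) hB hmB
    have h3 : |∫ E, (signedMean σ I₁ E j ^ 2 - 1) ^ m ∂P| ≤ m.factorial * C ^ m + 1 := by
      calc _ ≤ ∫ E, |(signedMean σ I₁ E j ^ 2 - 1) ^ m| ∂P := abs_integral_le_integral_abs
        _ ≤ ∫ E, (signedMean σ I₁ E j ^ (2 * m) + 1) ∂P :=
          integral_mono (hP.integrable_sq_sub_one_pow j m).abs
            ((hP.integrable_signedMean_pow j _).add (integrable_const 1))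
            fun E => abs_sq_sub_one_pow_le _ _
        _ = (∫ E, signedMean σ I₁ E j ^ (2 * m) ∂P) + 1 := by
          rw [integral_add (hP.integrable_signedMean_pow j _) (integrable_const 1)]; simp
        _ ≤ _ := by linarith
    have hfac : (1 : ℝ) ≤ m.factorial := by
      exact_mod_cast Nat.one_le_iff_ne_zero.2 m.factorial_ne_zero
    have h4 : (m.factorial : ℝ) * C ^ m + 1 ≤ m.factorial * (C + 1) ^ m := by
      have h5 : C ^ m + 1 ^ m ≤ (C + 1) ^ m := pow_add_pow_le hC0 zero_le_one (by omega)
      rw [one_pow] at h5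
      nlinarith
    exact mul_le_mul h1 (h3.trans h4) (abs_nonneg _) (Real.exp_pos _).le

end thresholded

/-- The columns of index `f i` or `g i` with `i < h`. -/
def pairIdx (n h : ℕ) (f g : ℕ → ℕ) : Finset (Fin n) :=
  Finset.univ.filter fun t => (t : ℕ) ∈ (Finset.range h).image f ∪ (Finset.range h).image g

/-- Sign `1` in the first half of the series and `-1` in the second half. -/
noncomputable def halfSign (n : ℕ) (t : Fin n) : ℝ := if 2 * (t : ℕ) < n then 1 else -1

lemma abs_halfSign {n : ℕ} (t : Fin n) : |halfSign n t| = 1 := by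
  unfold halfSign; split_ifs <;> simp

section pairIdx

variable {n h : ℕ} {f g : ℕ → ℕ}

lemma sum_pairIdx (hf : Set.InjOn f (Finset.range h)) (hg : Set.InjOn g (Finset.range h))
    (hfn : ∀ i < h, 2 * f i < n) (hgn : ∀ i < h, n ≤ 2 * g i ∧ g i < n) (F : ℕ → ℝ) :
    ∑ t ∈ pairIdx n h f g, F t = ∑ i ∈ Finset.range h, F (f i) + ∑ i ∈ Finset.range h, F (g i) := by
  rw [← Finset.sum_image hf, ← Finset.sum_image hg, ← Finset.sum_union]
  · refine Finset.sum_nbij (fun t => (t : ℕ)) ?_ ?_ ?_ ?_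
    · intro t ht; exact (Finset.mem_filter.1 ht).2
    · intro t _ t' _ h; exact Fin.ext h
    · intro m hm
      have hmn : m < n := by
        simp only [Finset.coe_union, Finset.coe_image, Set.mem_union, Set.mem_image,
          Finset.coe_range, Set.mem_Iio] at hm
        rcases hm with ⟨i, hi, rfl⟩ | ⟨i, hi, rfl⟩
        · have := hfn i hi; omega
        · exact (hgn i hi).2
      exact ⟨⟨m, hmn⟩, Finset.mem_coe.2 (Finset.mem_filter.2 ⟨Finset.mem_univ _, hm⟩), rfl⟩
    · intro t _; rfl
  · rw [Finset.disjoint_left]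
    intro m h1 h2
    rw [Finset.mem_image] at h1 h2
    obtain ⟨i, hi, rfl⟩ := h1
    obtain ⟨i', hi', h3⟩ := h2
    rw [Finset.mem_range] at hi hi'
    have := hfn i hi
    have := hgn i' hi'
    omega

lemma card_pairIdx (hf : Set.InjOn f (Finset.range h)) (hg : Set.InjOn g (Finset.range h))
    (hfn : ∀ i < h, 2 * f i < n) (hgn : ∀ i < h, n ≤ 2 * g i ∧ g i < n) :
    (pairIdx n h f g).card = 2 * h := by
  have := sum_pairIdx hf hg hfn hgn fun _ => 1
  simp only [Finset.sum_const, nsmul_eq_mul, mul_one, Finset.card_range] at this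
  have h2 : ((pairIdx n h f g).card : ℝ) = (2 * h : ℕ) := by rw [this]; push_cast; ring
  exact_mod_cast h2

lemma col_add {p : ℕ} (X Y : Fin n → Fin p → ℝ) (i : ℕ) (j : Fin p) :
    col p n (X + Y) i j = col p n X i j + col p n Y i j := by
  unfold col; split_ifs <;> simp

lemma col_eq {p : ℕ} (X : Fin n → Fin p → ℝ) {i : ℕ} (hi : i < n) : col p n X i = X ⟨i, hi⟩ := by
  simp [col, hi]

lemma signedMean_pairIdx {p : ℕ} (hf : Set.InjOn f (Finset.range h))
    (hg : Set.InjOn g (Finset.range h))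
    (hfn : ∀ i < h, 2 * f i < n) (hgn : ∀ i < h, n ≤ 2 * g i ∧ g i < n)
    (E : Fin n → Fin p → ℝ) (j : Fin p) :
    signedMean (halfSign n) (pairIdx n h f g) E j =
      (∑ i ∈ Finset.range h, (col p n E (f i) j - col p n E (g i) j)) / √((2 * h : ℕ) : ℝ) := by
  unfold signedMean
  rw [card_pairIdx hf hg hfn hgn]
  congr 1
  have h1 := sum_pairIdx hf hg hfn hgn
    fun m => (if 2 * m < n then (1 : ℝ) else -1) * col p n E m j
  rw [Finset.sum_sub_distrib, sub_eq_add_neg, ← Finset.sum_neg_distrib]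
  refine Eq.trans (Finset.sum_congr rfl fun t _ => ?_) (h1.trans ?_)
  · simp [halfSign, col]
  · congr 1
    · refine Finset.sum_congr rfl fun i hi => ?_
      rw [if_pos (hfn i (Finset.mem_range.1 hi)), one_mul]
    · refine Finset.sum_congr rfl fun i hi => ?_
      rw [if_neg (by have := (hgn i (Finset.mem_range.1 hi)).1; omega), neg_one_mul]

lemma sum_col_add_div {p : ℕ} (hf : Set.InjOn f (Finset.range h))
    (hg : Set.InjOn g (Finset.range h))
    (hfn : ∀ i < h, 2 * f i < n) (hgn : ∀ i < h, n ≤ 2 * g i ∧ g i < n)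
    (θ E : Fin n → Fin p → ℝ) (j : Fin p) {μ₁ μ₂ : Fin p → ℝ}
    (h₁ : ∀ i < h, col p n θ (f i) = μ₁) (h₂ : ∀ i < h, col p n θ (g i) = μ₂) :
    (∑ i ∈ Finset.range h, (col p n (θ + E) (f i) j - col p n (θ + E) (g i) j)) /
        √((2 * h : ℕ) : ℝ) =
      √((2 * h : ℕ) : ℝ) / 2 * (μ₁ j - μ₂ j) +
        signedMean (halfSign n) (pairIdx n h f g) E j := by
  rw [signedMean_pairIdx hf hg hfn hgn]
  have e1 : ∀ i ∈ Finset.range h, col p n (θ + E) (f i) j - col p n (θ + E) (g i) j =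
      (μ₁ j - μ₂ j) + (col p n E (f i) j - col p n E (g i) j) := by
    intro i hi
    rw [Finset.mem_range] at hi
    rw [col_add, col_add, h₁ i hi, h₂ i hi]; ring
  rw [Finset.sum_congr rfl e1, Finset.sum_add_distrib, add_div]
  congr 1
  rw [Finset.sum_const, Finset.card_range, nsmul_eq_mul]
  rcases Nat.eq_zero_or_pos h with rfl | hh
  · simp
  · have h3 : √((2 * h : ℕ) : ℝ) ^ 2 = 2 * h := by
      rw [Real.sq_sqrt (by positivity)]; push_cast; ring
    have h4 : (0 : ℝ) < √((2 * h : ℕ) : ℝ) := Real.sqrt_pos.2 (by positivity)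
    field_simp
    rw [h3]; ring

end pairIdx

/-- The columns entering `Y_{t,1}`, where `t = 2 * h`. -/
def idx₁ (n h : ℕ) : Finset (Fin n) := pairIdx n h (fun i => 2 * i) (fun i => n - 1 - 2 * i)

/-- The columns entering `Y_{t,2}`, where `t = 2 * h`. -/
def idx₂ (n h : ℕ) : Finset (Fin n) := pairIdx n h (fun i => 2 * i + 1) (fun i => n - 2 - 2 * i)

section statistics

variable {p n h : ℕ} {θ : Fin n → Fin p → ℝ} {μ₁ μ₂ : Fin p → ℝ}

lemma card_idx₁ (hh : 4 * h ≤ n) : (idx₁ n h).card = 2 * h := by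
  refine card_pairIdx ?_ ?_ ?_ ?_
  · intro i _ i' _ h; simp only at h; omega
  · intro i hi i' hi' h
    simp only [Finset.coe_range, Set.mem_Iio] at h hi hi'; omega
  · intro i hi; omega
  · intro i hi; omega

lemma card_idx₂ (hh : 4 * h ≤ n) : (idx₂ n h).card = 2 * h := by
  refine card_pairIdx ?_ ?_ ?_ ?_
  · intro i _ i' _ h; simp only at h; omega
  · intro i hi i' hi' h
    simp only [Finset.coe_range, Set.mem_Iio] at h hi hi'; omega
  · intro i hi; omega
  · intro i hi; omega

lemma disjoint_idx (hh : 4 * h ≤ n) : Disjoint (idx₁ n h) (idx₂ n h) := by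
  rw [Finset.disjoint_left]
  intro t h1 h2
  simp only [idx₁, idx₂, pairIdx, Finset.mem_filter, Finset.mem_univ, true_and, Finset.mem_union,
    Finset.mem_image, Finset.mem_range] at h1 h2
  rcases h1 with ⟨i, hi, h1⟩ | ⟨i, hi, h1⟩ <;> rcases h2 with ⟨i', hi', h2⟩ | ⟨i', hi', h2⟩ <;>
    omega

lemma Yt1_add (hh : 4 * h ≤ n) (h₁ : ∀ i : Fin n, (i : ℕ) < 2 * h → θ i = μ₁)
    (h₂ : ∀ i : Fin n, n ≤ i + 2 * h → θ i = μ₂) (E : Fin n → Fin p → ℝ) (j : Fin p) :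
    Yt1 p n (θ + E) (2 * h) j =
      √((2 * h : ℕ) : ℝ) / 2 * (μ₁ j - μ₂ j) + signedMean (halfSign n) (idx₁ n h) E j := by
  unfold Yt1
  rw [Nat.mul_div_cancel_left _ (by norm_num)]
  refine sum_col_add_div (f := fun i => 2 * i) (g := fun i => n - 1 - 2 * i) ?_ ?_ ?_ ?_ θ E j
    ?_ ?_
  · intro i _ i' _ h; simp only at h; omega
  · intro i hi i' hi' h
    simp only [Finset.coe_range, Set.mem_Iio] at h hi hi'; omega
  · intro i hi; omega
  · intro i hi; omega
  · intro i hi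
    rw [col_eq _ (by omega)]
    exact h₁ _ (by simp only; omega)
  · intro i hi
    rw [col_eq _ (by omega)]
    exact h₂ _ (by simp only; omega)

lemma Yt2_add (hh : 4 * h ≤ n) (h₁ : ∀ i : Fin n, (i : ℕ) < 2 * h → θ i = μ₁)
    (h₂ : ∀ i : Fin n, n ≤ i + 2 * h → θ i = μ₂) (E : Fin n → Fin p → ℝ) (j : Fin p) :
    Yt2 p n (θ + E) (2 * h) j =
      √((2 * h : ℕ) : ℝ) / 2 * (μ₁ j - μ₂ j) + signedMean (halfSign n) (idx₂ n h) E j := by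
  unfold Yt2
  rw [Nat.mul_div_cancel_left _ (by norm_num)]
  refine sum_col_add_div (f := fun i => 2 * i + 1) (g := fun i => n - 2 - 2 * i) ?_ ?_ ?_ ?_ θ E j
    ?_ ?_
  · intro i _ i' _ h; simp only at h; omega
  · intro i hi i' hi' h
    simp only [Finset.coe_range, Set.mem_Iio] at h hi hi'; omega
  · intro i hi; omega
  · intro i hi; omega
  · intro i hi
    rw [col_eq _ (by omega)]
    exact h₁ _ (by simp only; omega)
  · intro i hi
    rw [col_eq _ (by omega)]
    exact h₂ _ (by simp only; omega)

/-- The first and last column. -/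
def idxEnds (n : ℕ) : Finset (Fin n) := pairIdx n 1 (fun _ => 0) (fun _ => n - 1)

lemma card_idxEnds (hn : 2 ≤ n) : (idxEnds n).card = 2 := by
  refine card_pairIdx (by simp) (by simp) ?_ ?_
  · intro i hi; omega
  · intro i hi; omega

lemma Y1_add (hn : 2 ≤ n) (h₁ : ∀ i : Fin n, (i : ℕ) = 0 → θ i = μ₁)
    (h₂ : ∀ i : Fin n, n = i + 1 → θ i = μ₂) (E : Fin n → Fin p → ℝ) (j : Fin p) :
    Y1 p n (θ + E) j =
      √2 / 2 * (μ₁ j - μ₂ j) + signedMean (halfSign n) (idxEnds n) E j := by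
  have := sum_col_add_div (n := n) (h := 1) (f := fun _ => 0) (g := fun _ => n - 1) (by simp)
    (by simp) (fun i _ => by omega) (fun i _ => by omega) θ E j (μ₁ := μ₁) (μ₂ := μ₂)
    (fun i _ => by
      rw [col_eq _ (by omega)]
      exact h₁ _ rfl)
    (fun i _ => by
      rw [col_eq _ (by omega)]
      exact h₂ _ (by simp only; omega))
  simpa [Y1, idxEnds] using this

lemma Ata_two_mul_add (hh : 4 * h ≤ n)
    (h₁ : ∀ i : Fin n, (i : ℕ) < 2 * h → θ i = μ₁)
    (h₂ : ∀ i : Fin n, n ≤ i + 2 * h → θ i = μ₂) (E : Fin n → Fin p → ℝ) (a : ℝ) :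
    Ata p n (θ + E) (2 * h) a = ∑ j,
      ((√((2 * h : ℕ) : ℝ) / 2 * (μ₁ j - μ₂ j) + signedMean (halfSign n) (idx₁ n h) E j) ^ 2 - 1) *
        thr a (√((2 * h : ℕ) : ℝ) / 2 * (μ₁ j - μ₂ j) +
          signedMean (halfSign n) (idx₂ n h) E j) := by
  unfold Ata
  rw [if_neg (by omega)]
  refine Finset.sum_congr rfl fun j _ => ?_
  rw [Yt1_add hh h₁ h₂, Yt2_add hh h₁ h₂, thr]

lemma Ata_one_add (hn : 2 ≤ n) (h₁ : ∀ i : Fin n, (i : ℕ) = 0 → θ i = μ₁)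
    (h₂ : ∀ i : Fin n, n = i + 1 → θ i = μ₂) (E : Fin n → Fin p → ℝ) (a : ℝ) :
    Ata p n (θ + E) 1 a = ∑ j,
      ((√2 / 2 * (μ₁ j - μ₂ j) + signedMean (halfSign n) (idxEnds n) E j) ^ 2 - 1) *
        thr a (√2 / 2 * (μ₁ j - μ₂ j) + signedMean (halfSign n) (idxEnds n) E j) := by
  unfold Ata
  rw [if_pos rfl]
  refine Finset.sum_congr rfl fun j _ => ?_
  rw [Y1_add hn h₁ h₂, thr]

end statistics

/-- Moment exponent used at the dyadic scale `t = 2 ^ (k + 1)`. -/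
def expo (k : ℕ) : ℕ := 2 * (Nat.log 2 (k + 1) + 1)

lemma even_expo (k : ℕ) : Even (expo k) := even_two_mul _

lemma one_le_expo (k : ℕ) : 1 ≤ expo k := by unfold expo; omega

lemma sum_one_div_sq_le (N : ℕ) : ∑ k ∈ Finset.range N, 1 / ((k : ℝ) + 1) ^ 2 ≤ 2 := by
  have key : ∀ N : ℕ, ∑ k ∈ Finset.range (N + 1), 1 / ((k : ℝ) + 1) ^ 2 ≤ 2 - 1 / ((N : ℝ) + 1) := by
    intro N
    induction N with
    | zero => norm_num
    | succ N ih =>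
      rw [Finset.sum_range_succ]
      have h : 1 / (((N + 1 : ℕ) : ℝ) + 1) ^ 2 ≤ 1 / (N + 1 : ℝ) - 1 / ((N + 1 : ℕ) + 1 : ℝ) := by
        push_cast
        rw [div_sub_div _ _ (by positivity) (by positivity), div_le_div_iff₀ (by positivity)
          (by positivity)]
        have : (0 : ℝ) ≤ N := by positivity
        nlinarith
      linarith
  cases N with
  | zero => norm_num
  | succ N =>
    have h1 := key N
    have h2 : (0 : ℝ) ≤ 1 / (N + 1) := by positivity
    linarith

lemma pow_expo_le {δ : ℝ} (hδ0 : 0 ≤ δ) (hδ1 : δ ≤ 1) (k : ℕ) :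
    (δ / 2) ^ expo k ≤ δ * (1 / ((k : ℝ) + 1) ^ 2) := by
  set l := Nat.log 2 (k + 1)
  have h1 : ((k : ℝ) + 1) ≤ 2 ^ (l + 1) := by
    exact_mod_cast (Nat.lt_pow_succ_log_self (by norm_num : 1 < 2) (k + 1)).le
  calc (δ / 2) ^ expo k = (δ ^ 2) ^ (l + 1) * (1 / (2 ^ (l + 1)) ^ 2) := by
        rw [expo, div_pow, pow_mul, ← pow_mul, ← pow_mul, mul_comm (l + 1) 2]; ring
    _ ≤ δ * (1 / ((k : ℝ) + 1) ^ 2) := by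
        have h2 : (δ ^ 2) ^ (l + 1) ≤ δ := by
          rw [← pow_mul]
          exact pow_le_of_le_one hδ0 hδ1 (by omega)
        gcongr

lemma expo_le_two_mul (k : ℕ) : expo k ≤ 2 * (k + 2) := by
  have : Nat.log 2 (k + 1) < k + 1 := Nat.log_lt_self 2 (by omega)
  unfold expo; omega

lemma exists_expo_bound {α : ℝ} (hα : 0 < α) : ∃ B : ℝ, 1 ≤ B ∧ ∀ k : ℕ,
    ((2 * expo k : ℕ) : ℝ) ^ (1 / α) * √((2 * expo k : ℕ) / ((2 * 2 ^ k : ℕ) : ℝ)) ≤ B := by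
  set c : ℝ := 1 / α + 1 / 2 with hc
  have hc0 : 0 < c := by positivity
  refine ⟨max 1 ((c / (Real.log 2 / 8)) ^ c * 2), le_max_left _ _, fun k => ?_⟩
  refine le_trans ?_ (le_max_right _ _)
  have hl2 : 0 < Real.log 2 := Real.log_pos (by norm_num)
  set b : ℝ := Real.log 2 / 8 with hb
  have hb0 : 0 < b := by positivity
  set x : ℝ := 4 * ((k : ℝ) + 2) with hx
  have hx0 : 0 < x := by positivity
  have hE : ((2 * expo k : ℕ) : ℝ) ≤ x := by
    have : 2 * expo k ≤ 4 * (k + 2) := by have := expo_le_two_mul k; omega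
    rw [hx]; exact_mod_cast this
  have h1 : x ^ c ≤ (c / b) ^ c * Real.exp (x * b) := by
    have h2 : x * b / c ≤ Real.exp (x * b / c) := by
      linarith [Real.add_one_le_exp (x * b / c)]
    have h3 : x ≤ (c / b) * Real.exp (x * b / c) := by
      calc x = (c / b) * (x * b / c) := by field_simp
        _ ≤ _ := by gcongr
    calc x ^ c ≤ ((c / b) * Real.exp (x * b / c)) ^ c :=
          Real.rpow_le_rpow hx0.le h3 hc0.le
      _ = _ := by
        rw [Real.mul_rpow (by positivity) (by positivity), ← Real.exp_mul]
        congr 2; field_simp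
  have h4 : Real.exp (x * b) = 2 * √((2 : ℝ) ^ k) := by
    have : x * b = Real.log 2 + k * Real.log 2 / 2 := by rw [hx, hb]; ring
    rw [this, Real.exp_add, Real.exp_log (by norm_num), Real.exp_half, Real.exp_nat_mul,
      Real.exp_log (by norm_num)]
  calc _ ≤ x ^ (1 / α) * √(x / ((2 * 2 ^ k : ℕ) : ℝ)) := by gcongr
    _ = x ^ c / √((2 * 2 ^ k : ℕ) : ℝ) := by
      rw [Real.sqrt_div hx0.le, hc, Real.rpow_add hx0, Real.sqrt_eq_rpow x]; ring
    _ ≤ x ^ c / √((2 : ℝ) ^ k) := by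
      gcongr
      push_cast
      linarith [pow_pos (two_pos : (0 : ℝ) < 2) k]
    _ ≤ (c / b) ^ c * Real.exp (x * b) / √((2 : ℝ) ^ k) := by gcongr
    _ = _ := by rw [h4]; field_simp

lemma one_le_LL {n : ℕ} (hn : 2 ≤ n) : 1 ≤ LL n := by
  have hn' : (2 : ℝ) ≤ n := by exact_mod_cast hn
  have h2 := Real.log_two_gt_d9
  have he := Real.exp_one_lt_d9
  have h16 : Real.log 16 = 4 * Real.log 2 := by
    rw [show (16 : ℝ) = 2 ^ 4 by norm_num, Real.log_pow]; norm_num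
  have h1 : Real.exp 1 ≤ Real.log (8 * n) := by
    have : Real.log 16 ≤ Real.log (8 * n) := Real.log_le_log (by norm_num) (by linarith)
    linarith
  rw [LL, Real.le_log_iff_exp_le (lt_of_lt_of_le (Real.exp_pos 1) h1)]
  exact h1

lemma expo_le_LL {n k : ℕ} (hn : 2 ≤ n) (hk : k < Nat.log 2 (n / 2)) :
    (expo k : ℝ) ≤ 10 * LL n := by
  have hLL := one_le_LL hn
  have hn' : (2 : ℝ) ≤ n := by exact_mod_cast hn
  have h2 := Real.log_two_gt_d9
  have h22 := Real.log_two_lt_d9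
  have h3 : (k + 1 : ℝ) * Real.log 2 ≤ Real.log n := by
    have h4 : 2 ^ (k + 1) ≤ n := by
      have := Nat.pow_log_le_self 2 (x := n / 2) (by omega)
      have h5 : 2 ^ (k + 1) ≤ 2 ^ Nat.log 2 (n / 2) := Nat.pow_le_pow_right (by norm_num) hk
      omega
    have h5 : ((2 : ℝ) ^ (k + 1)) ≤ n := by exact_mod_cast h4
    have := Real.log_le_log (by positivity) h5
    rw [Real.log_pow] at this
    exact_mod_cast this
  have h8 : Real.log (8 * n) = 3 * Real.log 2 + Real.log n := by
    rw [Real.log_mul (by norm_num) (by positivity), show (8 : ℝ) = 2 ^ 3 by norm_num,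
      Real.log_pow]; norm_num
  have hln : 0 ≤ Real.log n := Real.log_nonneg (by linarith)
  set M := Real.log (8 * n) with hM
  have hM2 : 2 ≤ M := by rw [h8]; linarith
  have h6 : (k + 1 : ℝ) ≤ M ^ 2 := by nlinarith
  have h7 : Real.log (k + 1) ≤ 2 * LL n := by
    have := Real.log_le_log (by positivity) h6
    rw [Real.log_pow] at this
    exact_mod_cast this
  have h9 : (Nat.log 2 (k + 1) : ℝ) * Real.log 2 ≤ Real.log (k + 1) := by
    have h10 : ((2 : ℝ) ^ Nat.log 2 (k + 1)) ≤ (k + 1 : ℝ) := by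
      exact_mod_cast Nat.pow_log_le_self 2 (x := k + 1) (by omega)
    have := Real.log_le_log (by positivity) h10
    rwa [Real.log_pow] at this
  have h11 : (Nat.log 2 (k + 1) : ℝ) ≤ 4 * LL n := by
    have h12 : (0 : ℝ) ≤ (Nat.log 2 (k + 1) : ℝ) := by positivity
    nlinarith
  unfold expo
  push_cast
  linarith

lemma expo_threshold_le {n k : ℕ} (hn : 2 ≤ n) (hk : k < Nat.log 2 (n / 2)) {s : ℝ} (hs : 0 ≤ s) :
    √(s * expo k) + expo k ≤ 10 * (√(s * LL n) + LL n) := by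
  have h1 := expo_le_LL hn hk
  have hLL := one_le_LL hn
  have h2 : √(s * expo k) ≤ 10 * √(s * LL n) := by
    rw [Real.sqrt_le_left (by positivity), mul_pow, Real.sq_sqrt (by positivity)]
    have : s * (expo k : ℝ) ≤ s * (10 * LL n) := by gcongr
    have h3 : 0 ≤ s * LL n := by positivity
    linarith
  linarith

/-- Constant in the moment bound for the thresholded statistics. -/
noncomputable def momentConst (α D B : ℝ) : ℝ :=
  (2 * D * Real.exp (2 / α) * B * Real.exp 1) ^ 2 + 1

lemma momentConst_pos (α D B : ℝ) : 0 < momentConst α D B := by unfold momentConst; positivity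

/-- Admissibility of the thresholds `a`, `r`, `r₁` at sparsity `s` for target error `δ`. -/
structure Admissible (α D B C₁ δ : ℝ) (p n : ℕ) (s L a r r₁ : ℝ) : Prop where
  hα0 : 0 < α
  hα2 : α ≤ 2
  hD : 0 < D
  hB : 1 ≤ B
  expo_le : ∀ k : ℕ,
    ((2 * expo k : ℕ) : ℝ) ^ (1 / α) * √((2 * expo k : ℕ) / ((2 * 2 ^ k : ℕ) : ℝ)) ≤ B
  hC₁ : 1 ≤ C₁
  hDC : Real.exp 1 * (2 * D * Real.exp 1 ^ 3) * 4 ^ (1 / α) ≤ C₁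
  hδ0 : 0 < δ
  hδ1 : δ ≤ 1
  hn : 2 ≤ n
  hs : 0 < s
  hL : 1 ≤ L
  card_le : p * Real.exp (-L) ≤ s
  ha : C₁ * L ^ (1 / α) ≤ a
  hr : ∀ k < Nat.log 2 (n / 2),
    8 * momentConst α D B / δ * (√(s * expo k) + expo k) ≤ r
  hr₁ : (C₁ * L ^ (1 / α)) ^ 2 * s ≤ δ * r₁

section bounds

variable {α D B C₁ δ : ℝ} {p n : ℕ} {s L a r r₁ : ℝ}

lemma Admissible.one_le_a (h : Admissible α D B C₁ δ p n s L a r r₁) : 1 ≤ a := by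
  refine le_trans ?_ h.ha
  have := h.hα0
  have h1 : 1 ≤ L ^ (1 / α) := Real.one_le_rpow h.hL (by positivity)
  nlinarith [h.hC₁]

lemma Admissible.r₁_pos (h : Admissible α D B C₁ δ p n s L a r r₁) : 0 < r₁ := by
  have h1 := h.hs
  have h2 := h.hL
  have h3 := h.hC₁
  have : 0 < (C₁ * L ^ (1 / α)) ^ 2 * s := by positivity
  exact pos_of_mul_pos_right (lt_of_lt_of_le this h.hr₁) h.hδ0.le

lemma Admissible.r_pos (h : Admissible α D B C₁ δ p n s L a r r₁) {k : ℕ}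
    (hk : k < Nat.log 2 (n / 2)) : 0 < r := by
  have h1 := h.hs
  have h2 := momentConst_pos α D B
  have h3 := h.hδ0
  have h4 : (0 : ℝ) < expo k := by exact_mod_cast one_le_expo k
  exact lt_of_lt_of_le (by positivity) (h.hr k hk)

lemma four_mul_two_pow_le {n k : ℕ} (hn : 2 ≤ n) (hk : k < Nat.log 2 (n / 2)) :
    4 * 2 ^ k ≤ n := by
  have h1 := Nat.pow_log_le_self 2 (x := n / 2) (by omega)
  have h2 : 2 ^ (k + 1) ≤ 2 ^ Nat.log 2 (n / 2) := Nat.pow_le_pow_right (by norm_num) hk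
  rw [pow_succ] at h2
  omega

/-- The noise part of `A_{t,a}` restricted to the coordinates in `U`, at `t = 2 ^ (k + 1)`. -/
noncomputable def noiseStat (n k : ℕ) (a : ℝ) (U : Finset (Fin p)) (E : Fin n → Fin p → ℝ) : ℝ :=
  ∑ j ∈ U, thrTerm (halfSign n) (idx₁ n (2 ^ k)) (idx₂ n (2 ^ k)) a j E

variable {P : Measure (Fin n → Fin p → ℝ)}

lemma SubWeibullNoise.integrable_noiseStat (hP : SubWeibullNoise α D P) (k : ℕ)
    (U : Finset (Fin p)) {Q : ℕ} : Integrable (fun E => (noiseStat n k a U E / r) ^ Q) P := by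
  have := hP.isProbabilityMeasure
  have h1 : MemLp (fun E => noiseStat n k a U E / r) Q P := by
    simp_rw [div_eq_mul_inv]
    exact (memLp_finsetSum U fun j _ => hP.memLp_thrTerm j Q).mul_const _
  refine h1.integrable_norm_pow'.mono' (h1.aestronglyMeasurable.pow Q)
    (Filter.Eventually.of_forall fun E => ?_)
  simp

lemma Admissible.moment_noiseStat_le (h : Admissible α D B C₁ δ p n s L a r r₁)
    (hP : SubWeibullNoise α D P) {k : ℕ} (hk : k < Nat.log 2 (n / 2)) (U : Finset (Fin p)) :
    ∫ E, (noiseStat n k a U E / r) ^ expo k ∂P ≤ δ * (1 / ((k : ℝ) + 1) ^ 2) := by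
  have h4 := four_mul_two_pow_le h.hn hk
  have c1 := card_idx₁ h4
  have c2 := card_idx₂ h4
  have hm := momentConst_pos α D B
  have hδ := h.hδ0
  have key := hP.moment_sum_thrTerm_le (σ := halfSign n) (Q := expo k) (B := B) (s := s) (r := r)
    (R := 8 * momentConst α D B / δ) (a := a)
    abs_halfSign h.hα0 h.hα2 h.hD (disjoint_idx h4) (by rw [c1]; positivity)
    (by rw [c2]; positivity) h.hL (by linarith [h.hC₁]) h.hDC h.ha (one_le_expo k) h.hB
    (by rw [c1]; exact h.expo_le k) h.hs (by positivity) (h.hr k hk) U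
    (by
      refine le_trans ?_ h.card_le
      have : U.card ≤ p := by simpa using Finset.card_le_univ U
      gcongr)
  refine key.trans ?_
  rw [← momentConst, show 4 * momentConst α D B / (8 * momentConst α D B / δ) = δ / 2 by
    field_simp; ring]
  exact pow_expo_le h.hδ0.le h.hδ1 k

lemma phiGsparse_nonneg (X : Fin n → Fin p → ℝ) : 0 ≤ phiGsparse p n a r r₁ X := by
  unfold phiGsparse; split_ifs <;> norm_num

lemma phiGsparse_le_one (X : Fin n → Fin p → ℝ) : phiGsparse p n a r r₁ X ≤ 1 := by
  unfold phiGsparse; split_ifs <;> norm_num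

lemma one_le_div_pow {x r : ℝ} (hr : 0 < r) (hx : r ≤ |x|) {Q : ℕ} (hQ : Even Q) :
    1 ≤ (x / r) ^ Q := by
  rw [← hQ.pow_abs, abs_div, abs_of_pos hr]
  exact one_le_pow₀ ((one_le_div hr).2 hx)

/-- Bound on the type I error. -/
lemma Admissible.integral_phi_le (h : Admissible α D B C₁ δ p n s L a r r₁)
    (hP : SubWeibullNoise α D P) {θ : Fin n → Fin p → ℝ} (hθ : θ ∈ Theta0 p n) :
    ∫ E, phiGsparse p n a r r₁ (θ + E) ∂P ≤ 3 * δ := by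
  obtain ⟨μ, hμ⟩ := hθ
  have hr₁ := h.r₁_pos
  set N := Nat.log 2 (n / 2) with hN
  set ends : (Fin n → Fin p → ℝ) → Fin p → ℝ := signedMean (halfSign n) (idxEnds n) with hends
  have hpt : ∀ E, phiGsparse p n a r r₁ (θ + E) ≤
      ∑ k ∈ Finset.range N, (noiseStat n k a Finset.univ E / r) ^ expo k +
        (∑ j, ends E j ^ 2 * thr a (ends E j)) / r₁ := by
    intro E
    have p1 : ∀ k ∈ Finset.range N, 0 ≤ (noiseStat n k a Finset.univ E / r) ^ expo k :=
      fun k _ => (even_expo k).pow_nonneg _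
    have p2 : 0 ≤ (∑ j, ends E j ^ 2 * thr a (ends E j)) / r₁ :=
      div_nonneg (Finset.sum_nonneg fun j _ => mul_nonneg (sq_nonneg _) (thr_nonneg _ _)) hr₁.le
    have p3 := Finset.sum_nonneg p1
    unfold phiGsparse
    split_ifs with hc
    · rcases hc with ⟨t, ht, ht1, hA⟩ | hA
      · rw [Tgrid, Finset.mem_image] at ht
        obtain ⟨k', hk', rfl⟩ := ht
        obtain ⟨k, rfl⟩ : ∃ k, k' = k + 1 :=
          Nat.exists_eq_succ_of_ne_zero (by rintro rfl; simp at ht1)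
        have hk : k < N := by rw [Finset.mem_range] at hk'; omega
        rw [pow_succ, mul_comm, Ata_two_mul_add (four_mul_two_pow_le h.hn hk)
          (fun i _ => hμ i) (fun i _ => hμ i)] at hA
        simp only [sub_self, mul_zero, zero_add] at hA
        have h1 : 1 ≤ (noiseStat n k a Finset.univ E / r) ^ expo k :=
          one_le_div_pow (h.r_pos hk) (hA.le.trans (le_abs_self _)) (even_expo k)
        have h2 := Finset.single_le_sum p1 (Finset.mem_range.2 hk)
        linarith
      · rw [Ata_one_add h.hn (fun i _ => hμ i) (fun i _ => hμ i)] at hA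
        simp only [sub_self, mul_zero, zero_add] at hA
        have h1 : 1 ≤ (∑ j, ends E j ^ 2 * thr a (ends E j)) / r₁ := by
          rw [one_le_div hr₁]
          refine hA.le.trans (Finset.sum_le_sum fun j _ => ?_)
          exact mul_le_mul_of_nonneg_right (by linarith) (thr_nonneg _ _)
        linarith
    · linarith
  have hi2 : ∀ j, Integrable (fun E => ends E j ^ 2 * thr a (ends E j)) P := by
    intro j
    have m1 := measurable_signedMean (p := p) (halfSign n) (idxEnds n) j
    refine (hP.integrable_signedMean_pow (σ := halfSign n) (I := idxEnds n) j 2).mono'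
      ((m1.pow_const 2).mul ((measurable_thr a).comp m1)).aestronglyMeasurable
      (Filter.Eventually.of_forall fun E => ?_)
    rw [Real.norm_of_nonneg (mul_nonneg (sq_nonneg _) (thr_nonneg _ _))]
    exact mul_le_of_le_one_right (sq_nonneg _) (thr_le_one _ _)
  have hi1 : Integrable (fun E => ∑ k ∈ Finset.range N,
      (noiseStat n k a Finset.univ E / r) ^ expo k) P :=
    integrable_finsetSum _ fun k _ => hP.integrable_noiseStat k _
  have hi3 : Integrable (fun E => (∑ j, ends E j ^ 2 * thr a (ends E j)) / r₁) P :=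
    (integrable_finsetSum _ fun j _ => hi2 j).div_const _
  have hint := integral_mono_of_nonneg
    (Filter.Eventually.of_forall fun E => phiGsparse_nonneg (θ + E)) (hi1.add hi3)
    (Filter.Eventually.of_forall hpt)
  refine hint.trans ?_
  simp only [Pi.add_apply]
  rw [integral_add hi1 hi3, integral_finsetSum _ fun k _ => hP.integrable_noiseStat k _,
    integral_div, integral_finsetSum _ fun j _ => hi2 j]
  have s1 : ∑ k ∈ Finset.range N, ∫ E, (noiseStat n k a Finset.univ E / r) ^ expo k ∂P ≤
      δ * 2 := by
    refine (Finset.sum_le_sum fun k hk =>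
      h.moment_noiseStat_le hP (Finset.mem_range.1 hk) Finset.univ).trans ?_
    rw [← Finset.mul_sum]
    exact mul_le_mul_of_nonneg_left (sum_one_div_sq_le N) h.hδ0.le
  have s2 : (∑ j, ∫ E, ends E j ^ 2 * thr a (ends E j) ∂P) / r₁ ≤ δ := by
    rw [div_le_iff₀ hr₁]
    refine le_trans ?_ h.hr₁
    refine (Finset.sum_le_sum fun j _ => hP.integral_sq_mul_thr_le j abs_halfSign h.hα0 h.hα2 h.hD
      (by rw [card_idxEnds h.hn]; norm_num) h.hL (by linarith [h.hC₁]) h.hDC h.ha).trans ?_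
    rw [Finset.sum_const, Finset.card_univ, Fintype.card_fin, nsmul_eq_mul]
    nlinarith [mul_le_mul_of_nonneg_left h.card_le (sq_nonneg (C₁ * L ^ (1 / α)))]
  linarith

end bounds

lemma half_sq_sub_le {a m z₁ z₂ : ℝ} (ha : 1 ≤ a) :
    m ^ 2 / 2 - 2 * a ^ 2 - (z₁ ^ 2 + z₂ ^ 2) ≤ ((m + z₁) ^ 2 - 1) * thr a (m + z₂) := by
  unfold thr
  split_ifs with h
  · nlinarith [sq_nonneg (m + 2 * z₁), sq_nonneg z₂]
  · have h1 : (m + z₂) ^ 2 ≤ a ^ 2 := sq_le_sq' (by linarith [(abs_lt.1 (not_le.1 h)).1])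
      (abs_lt.1 (not_le.1 h)).2.le
    nlinarith [sq_nonneg (m + 2 * z₂), sq_nonneg z₁]

lemma sum_half_sq_sub_le {ι : Type*} {a s : ℝ} (ha : 1 ≤ a) {J : Finset ι} (hJ : (J.card : ℝ) ≤ s)
    (m z₁ z₂ : ι → ℝ) :
    (∑ j ∈ J, m j ^ 2) / 2 - 2 * s * a ^ 2 - ∑ j ∈ J, (z₁ j ^ 2 + z₂ j ^ 2) ≤
      ∑ j ∈ J, ((m j + z₁ j) ^ 2 - 1) * thr a (m j + z₂ j) := by
  refine le_trans ?_ (Finset.sum_le_sum fun j _ => half_sq_sub_le (m := m j) (z₁ := z₁ j)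
    (z₂ := z₂ j) ha)
  rw [Finset.sum_sub_distrib, Finset.sum_sub_distrib, ← Finset.sum_div, Finset.sum_const,
    nsmul_eq_mul]
  nlinarith [mul_le_mul_of_nonneg_right hJ (sq_nonneg a)]

lemma sq_sub_one_mul_thr_nonneg {a x : ℝ} (ha : 1 ≤ a) : 0 ≤ (x ^ 2 - 1) * thr a x := by
  unfold thr
  split_ifs with h
  · have : 1 ≤ |x| := ha.trans h
    have := one_le_pow₀ this (n := 2)
    rw [sq_abs] at this
    linarith
  · simp

/-- A mean with one change point is constant on blocks of dyadic length at both ends, and these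
blocks capture a constant fraction of the signal. -/
lemma exists_dyadic_of_mem_Theta1 {p n s : ℕ} {ρ : ℝ} {θ : Fin n → Fin p → ℝ}
    (hθ : θ ∈ Theta1 p n s ρ) :
    ∃ k ≤ Nat.log 2 (n / 2), ∃ μ₁ μ₂ : Fin p → ℝ,
      (∀ i : Fin n, (i : ℕ) < 2 ^ k → θ i = μ₁) ∧ (∀ i : Fin n, n ≤ i + 2 ^ k → θ i = μ₂) ∧
      l0 p (fun j => μ₁ j - μ₂ j) ≤ s ∧
      ρ ^ 2 ≤ 2 * 2 ^ k * sqnorm p (fun j => μ₁ j - μ₂ j) := by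
  simp only [Theta1, Set.mem_iUnion, Finset.mem_Icc] at hθ
  obtain ⟨t₀, ⟨h1, h2⟩, μ₁, μ₂, hμ₁, hμ₂, hl, hρ⟩ := hθ
  set m := min t₀ (n - t₀) with hm
  have hm0 : m ≠ 0 := by omega
  have hle := Nat.pow_log_le_self 2 hm0
  have hlt := Nat.lt_pow_succ_log_self (b := 2) (by norm_num) m
  refine ⟨Nat.log 2 m, Nat.log_mono_right (by omega), μ₁, μ₂, fun i hi => hμ₁ i (by omega),
    fun i hi => hμ₂ i (by omega), hl, hρ.trans ?_⟩
  have hsq : 0 ≤ sqnorm p (fun j => μ₁ j - μ₂ j) := Finset.sum_nonneg fun j _ => sq_nonneg _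
  refine mul_le_mul_of_nonneg_right ?_ hsq
  have hn : (0 : ℝ) < n := by exact_mod_cast (by omega : 0 < n)
  have hm2 : (m : ℝ) ≤ 2 * 2 ^ Nat.log 2 m := by
    rw [pow_succ, mul_comm] at hlt
    exact_mod_cast hlt.le
  refine le_trans ?_ hm2
  have ht : (t₀ : ℝ) ≤ n := by exact_mod_cast (by omega : t₀ ≤ n)
  have ht0 : (0 : ℝ) ≤ t₀ := by positivity
  rw [div_le_iff₀ hn, hm, Nat.cast_min, Nat.cast_sub (by omega)]
  rcases le_total (t₀ : ℝ) (n - t₀) with h | h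
  · rw [min_eq_left h]; nlinarith
  · rw [min_eq_right h]; nlinarith

section power

variable {α D B C₁ δ : ℝ} {p n : ℕ} {s L a r r₁ : ℝ} {P : Measure (Fin n → Fin p → ℝ)}

lemma SubWeibullNoise.integrable_sum_sq_signedMean (hP : SubWeibullNoise α D P)
    (J : Finset (Fin p)) {σ : Fin n → ℝ} (I₁ I₂ : Finset (Fin n)) :
    Integrable (fun E => ∑ j ∈ J, (signedMean σ I₁ E j ^ 2 + signedMean σ I₂ E j ^ 2)) P :=
  integrable_finsetSum _ fun j _ =>
    (hP.integrable_signedMean_pow j 2).add (hP.integrable_signedMean_pow j 2)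

lemma SubWeibullNoise.integral_sum_sq_signedMean (hP : SubWeibullNoise α D P)
    (J : Finset (Fin p)) {σ : Fin n → ℝ} (hσ : ∀ i, |σ i| = 1) {I₁ I₂ : Finset (Fin n)}
    (h₁ : 0 < I₁.card) (h₂ : 0 < I₂.card) :
    ∫ E, ∑ j ∈ J, (signedMean σ I₁ E j ^ 2 + signedMean σ I₂ E j ^ 2) ∂P = 2 * J.card := by
  have hi : ∀ j, Integrable (fun E => signedMean σ I₁ E j ^ 2 + signedMean σ I₂ E j ^ 2) P :=
    fun j => (hP.integrable_signedMean_pow j 2).add (hP.integrable_signedMean_pow j 2)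
  rw [integral_finsetSum _ fun j _ => hi j]
  have : ∀ j, ∫ E, (signedMean σ I₁ E j ^ 2 + signedMean σ I₂ E j ^ 2) ∂P = 2 := fun j => by
    rw [integral_add (hP.integrable_signedMean_pow j 2) (hP.integrable_signedMean_pow j 2),
      hP.sq_signedMean j hσ h₁, hP.sq_signedMean j hσ h₂]
    norm_num
  simp only [this, Finset.sum_const, nsmul_eq_mul]
  ring

/-- Bound on the type II error. -/
lemma Admissible.integral_one_sub_phi_le (h : Admissible α D B C₁ δ p n s L a r r₁)
    (hP : SubWeibullNoise α D P) {s' : ℕ} (hs' : (s' : ℝ) ≤ s) {ρ : ℝ}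
    (hr0 : 0 ≤ r) (hρ : 2 * s * a ^ 2 + 2 * r + r₁ + s / δ ≤ ρ ^ 2 / 16)
    {θ : Fin n → Fin p → ℝ} (hθ : θ ∈ Theta1 p n s' ρ) :
    ∫ E, (1 - phiGsparse p n a r r₁ (θ + E)) ∂P ≤ 3 * δ := by
  obtain ⟨k', hk', μ₁, μ₂, hμ₁, hμ₂, hl, hsig⟩ := exists_dyadic_of_mem_Theta1 hθ
  have hδ := h.hδ0
  have hs := h.hs
  have hr₁ := h.r₁_pos
  have ha := h.one_le_a
  set J : Finset (Fin p) := Finset.univ.filter fun j => μ₁ j - μ₂ j ≠ 0 with hJ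
  have hJs : (J.card : ℝ) ≤ s := by
    refine le_trans ?_ hs'
    exact_mod_cast hl
  have hJ0 : ∀ j ∈ Jᶜ, μ₁ j - μ₂ j = 0 := fun j hj => by
    simpa [hJ] using hj
  have hJsum : ∑ j ∈ J, (μ₁ j - μ₂ j) ^ 2 = sqnorm p (fun j => μ₁ j - μ₂ j) := by
    rw [sqnorm, ← Finset.sum_add_sum_compl J, Finset.sum_eq_zero (s := Jᶜ) fun j hj => by
      rw [hJ0 j hj]; norm_num]
    simp
  have h0 : ∀ E, 0 ≤ 1 - phiGsparse p n a r r₁ (θ + E) := fun E => by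
    linarith [phiGsparse_le_one (a := a) (r := r) (r₁ := r₁) (θ + E)]
  have hmark : ∀ (I₁ I₂ : Finset (Fin n)), 0 < I₁.card → 0 < I₂.card →
      ∫ E, (∑ j ∈ J, (signedMean (halfSign n) I₁ E j ^ 2 + signedMean (halfSign n) I₂ E j ^ 2)) /
        (s / δ) ∂P ≤ 2 * δ := fun I₁ I₂ h₁ h₂ => by
    rw [integral_div, hP.integral_sum_sq_signedMean J abs_halfSign h₁ h₂,
      div_le_iff₀ (by positivity)]
    have : 2 * δ * (s / δ) = 2 * s := by field_simp
    linarith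
  rcases Nat.eq_zero_or_pos k' with rfl | hpos
  · have hc : 0 < (idxEnds n).card := by rw [card_idxEnds h.hn]; norm_num
    refine (integral_mono_of_nonneg (Filter.Eventually.of_forall h0)
      ((hP.integrable_sum_sq_signedMean J (idxEnds n) (idxEnds n)).div_const (s / δ))
      (Filter.Eventually.of_forall fun E => ?_)).trans ((hmark _ _ hc hc).trans (by linarith))
    have hW : 0 ≤ ∑ j ∈ J, (signedMean (halfSign n) (idxEnds n) E j ^ 2 +
      signedMean (halfSign n) (idxEnds n) E j ^ 2) := Finset.sum_nonneg fun j _ => by positivity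
    show 1 - phiGsparse p n a r r₁ (θ + E) ≤ _
    unfold phiGsparse
    split_ifs with hφ
    · rw [sub_self]; positivity
    rw [not_or, not_lt] at hφ
    have hA := hφ.2
    rw [Ata_one_add h.hn (fun i hi => hμ₁ i (by simp [hi])) (fun i hi => hμ₂ i (by simp [← hi])),
      ← Finset.sum_add_sum_compl J] at hA
    have hA2 := Finset.sum_nonneg (s := Jᶜ) fun j _ => sq_sub_one_mul_thr_nonneg
      (x := √2 / 2 * (μ₁ j - μ₂ j) + signedMean (halfSign n) (idxEnds n) E j) ha
    have hA1 := sum_half_sq_sub_le ha hJs (fun j => √2 / 2 * (μ₁ j - μ₂ j))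
      (signedMean (halfSign n) (idxEnds n) E) (signedMean (halfSign n) (idxEnds n) E)
    simp only [mul_pow, div_pow, Nat.ofNat_nonneg, Real.sq_sqrt] at hA1
    rw [← Finset.mul_sum, hJsum] at hA1
    rw [sub_zero, one_le_div (by positivity)]
    norm_num at hsig hA1
    linarith [sq_nonneg ρ]
  · obtain ⟨k, rfl⟩ : ∃ k, k' = k + 1 := ⟨k' - 1, by omega⟩
    have hk : k < Nat.log 2 (n / 2) := hk'
    have h4 := four_mul_two_pow_le h.hn hk
    have hc₁ : 0 < (idx₁ n (2 ^ k)).card := by rw [card_idx₁ h4]; positivity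
    have hc₂ : 0 < (idx₂ n (2 ^ k)).card := by rw [card_idx₂ h4]; positivity
    have hrpos := h.r_pos hk
    have hi1 := hP.integrable_noiseStat (a := a) (r := r) k Jᶜ (Q := expo k)
    have hi2 := (hP.integrable_sum_sq_signedMean (σ := halfSign n) J (idx₁ n (2 ^ k))
      (idx₂ n (2 ^ k))).div_const (s / δ)
    have hmom : ∫ E, (noiseStat n k a Jᶜ E / r) ^ expo k ∂P ≤ δ := by
      refine (h.moment_noiseStat_le hP hk Jᶜ).trans (mul_le_of_le_one_right hδ.le ?_)
      rw [div_le_one (by positivity)]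
      exact one_le_pow₀ (by linarith [Nat.cast_nonneg (α := ℝ) k])
    refine (integral_mono_of_nonneg (Filter.Eventually.of_forall h0) (hi1.add hi2)
      (Filter.Eventually.of_forall fun E => ?_)).trans ?_
    · have hW : 0 ≤ ∑ j ∈ J, (signedMean (halfSign n) (idx₁ n (2 ^ k)) E j ^ 2 +
        signedMean (halfSign n) (idx₂ n (2 ^ k)) E j ^ 2) :=
        Finset.sum_nonneg fun j _ => by positivity
      have hW' : 0 ≤ (∑ j ∈ J, (signedMean (halfSign n) (idx₁ n (2 ^ k)) E j ^ 2 +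
        signedMean (halfSign n) (idx₂ n (2 ^ k)) E j ^ 2)) / (s / δ) := by positivity
      have hV : 0 ≤ (noiseStat n k a Jᶜ E / r) ^ expo k := (even_expo k).pow_nonneg _
      show 1 - phiGsparse p n a r r₁ (θ + E) ≤ (noiseStat n k a Jᶜ E / r) ^ expo k +
        (∑ j ∈ J, (signedMean (halfSign n) (idx₁ n (2 ^ k)) E j ^ 2 +
          signedMean (halfSign n) (idx₂ n (2 ^ k)) E j ^ 2)) / (s / δ)
      unfold phiGsparse
      split_ifs with hφ
      · linarith
      rw [sub_zero]
      push Not at hφ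
      have hA := hφ.1 (2 ^ (k + 1))
        (Finset.mem_image_of_mem _ (Finset.mem_range.2 (by omega))) (by simp)
      rw [pow_succ, mul_comm] at hμ₁ hμ₂ hA
      rw [Ata_two_mul_add h4 hμ₁ hμ₂, ← Finset.sum_add_sum_compl J] at hA
      have hcompl : ∑ j ∈ Jᶜ, ((√((2 * 2 ^ k : ℕ) : ℝ) / 2 * (μ₁ j - μ₂ j) +
          signedMean (halfSign n) (idx₁ n (2 ^ k)) E j) ^ 2 - 1) *
          thr a (√((2 * 2 ^ k : ℕ) : ℝ) / 2 * (μ₁ j - μ₂ j) +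
            signedMean (halfSign n) (idx₂ n (2 ^ k)) E j) = noiseStat n k a Jᶜ E :=
        Finset.sum_congr rfl fun j hj => by rw [hJ0 j hj, mul_zero, zero_add, zero_add]; rfl
      rw [hcompl] at hA
      have hA1 := sum_half_sq_sub_le ha hJs (fun j => √((2 * 2 ^ k : ℕ) : ℝ) / 2 * (μ₁ j - μ₂ j))
        (signedMean (halfSign n) (idx₁ n (2 ^ k)) E) (signedMean (halfSign n) (idx₂ n (2 ^ k)) E)
      simp only [mul_pow, div_pow, Nat.cast_nonneg, Real.sq_sqrt] at hA1
      rw [← Finset.mul_sum, hJsum] at hA1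
      by_cases hv : r ≤ |noiseStat n k a Jᶜ E|
      · linarith [one_le_div_pow hrpos hv (even_expo k)]
      · have hv' := (abs_lt.1 (not_le.1 hv)).1
        have : 1 ≤ (∑ j ∈ J, (signedMean (halfSign n) (idx₁ n (2 ^ k)) E j ^ 2 +
            signedMean (halfSign n) (idx₂ n (2 ^ k)) E j ^ 2)) / (s / δ) := by
          rw [one_le_div (by positivity)]
          rw [pow_succ (2 : ℝ)] at hsig
          push_cast at hA1 hA
          linarith
        linarith
    · simp only [Pi.add_apply]
      rw [integral_add hi1 hi2]
      linarith [hmark _ _ hc₁ hc₂]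

end power

lemma risk_le {p n : ℕ} {Q : Set (Measure (Fin n → Fin p → ℝ))} {Θ₁ : Set (Fin n → Fin p → ℝ)}
    {φ : (Fin n → Fin p → ℝ) → ℝ} {η : ℝ} (hη : 0 ≤ η)
    (h₀ : ∀ P ∈ Q, ∀ θ ∈ Theta0 p n, ∫ E, φ (θ + E) ∂P ≤ η)
    (h₁ : ∀ P ∈ Q, ∀ θ ∈ Θ₁, ∫ E, (1 - φ (θ + E)) ∂P ≤ η) :
    risk p n Q Θ₁ φ ≤ η + η :=
  add_le_add
    (Real.iSup_le (fun P => Real.iSup_le (fun hP => Real.iSup_le (fun θ => Real.iSup_le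
      (fun hθ => h₀ P hP θ hθ) hη) hη) hη) hη)
    (Real.iSup_le (fun P => Real.iSup_le (fun hP => Real.iSup_le (fun θ => Real.iSup_le
      (fun hθ => h₁ P hP θ hθ) hη) hη) hη) hη)

lemma mul_sq_threshold_le {C s x l : ℝ} (hs : 1 ≤ s) (hl : 0 ≤ l) :
    s * (C * (x + s ^ (-(1 : ℝ) / 2) * √l)) ^ 2 ≤ 2 * C ^ 2 * (s * x ^ 2 + l) := by
  have hs0 : 0 < s := by linarith
  have h1 : (s ^ (-(1 : ℝ) / 2)) ^ 2 = s⁻¹ := by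
    rw [← Real.rpow_natCast, ← Real.rpow_mul hs0.le, ← Real.rpow_neg_one]
    norm_num
  have h2 : (x + s ^ (-(1 : ℝ) / 2) * √l) ^ 2 ≤ 2 * (x ^ 2 + s⁻¹ * l) := by
    refine (add_sq_le (a := x) (b := s ^ (-(1 : ℝ) / 2) * √l)).trans_eq ?_
    rw [mul_pow, h1, Real.sq_sqrt hl]
  calc _ = C ^ 2 * s * (x + s ^ (-(1 : ℝ) / 2) * √l) ^ 2 := by ring
    _ ≤ C ^ 2 * s * (2 * (x ^ 2 + s⁻¹ * l)) := by gcongr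
    _ = _ := by field_simp

lemma one_le_log_exp_mul_div {p s : ℝ} (hs : 0 < s) (hsp : s ≤ p) :
    1 ≤ Real.log (Real.exp 1 * p / s) := by
  have hp : 0 < p := by linarith
  rw [Real.le_log_iff_exp_le (by positivity), mul_div_assoc]
  exact le_mul_of_one_le_right (Real.exp_pos _).le ((one_le_div hs).2 hsp)

lemma mul_exp_neg_log_le {p s : ℝ} (hs : 0 < s) (hsp : s ≤ p) :
    p * Real.exp (-Real.log (Real.exp 1 * p / s)) ≤ s := by
  have hp : 0 < p := by linarith
  rw [Real.exp_neg, Real.exp_log (by positivity)]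
  calc _ = s / Real.exp 1 := by field_simp
    _ ≤ s := div_le_self hs.le (Real.one_le_exp zero_le_one)

/-- Theorem: sparse testing under sub-Weibull noise. -/
theorem statement_1 (α K ε : ℝ) (hα0 : 0 < α) (hα2 : α ≤ 2) (hK : 0 < K)
    (hε0 : 0 < ε) (hε1 : ε < 1) :
    ∃ C₁ C₂ C₃ C₄ : ℝ, 0 < C₁ ∧ 0 < C₂ ∧ 0 < C₃ ∧ 0 < C₄ ∧
      ∀ p n s : ℕ, 0 < p → 2 ≤ n → 1 ≤ s → s ≤ p → ∀ ρ : ℝ,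
        C₄ * ((s : ℝ) * Real.log (Real.exp 1 * (p : ℝ) / (s : ℝ)) ^ ((2 : ℝ) / α) + LL n) ≤ ρ ^ 2 →
        risk p n (Gclass p n α K) (Theta1 p n s ρ)
          (phiGsparse p n
            (C₁ * (Real.log (Real.exp 1 * (p : ℝ) / (s : ℝ)) ^ ((1 : ℝ) / α) +
              ((s : ℝ) ^ (-(1 : ℝ) / 2)) * Real.sqrt (LL n)))
            (C₂ * (Real.sqrt ((s : ℝ) * LL n) + LL n))
            (C₃ * (s : ℝ) * Real.log (Real.exp 1 * (p : ℝ) / (s : ℝ)) ^ ((2 : ℝ) / α))) ≤ ε := by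
  obtain ⟨B, hB, hBle⟩ := exists_expo_bound hα0
  set D := K * (1 / α) ^ (1 / α) with hDdef
  have hD : 0 < D := by positivity
  set δ := ε / 8 with hδdef
  have hδ : 0 < δ := by positivity
  set M := momentConst α D B with hM
  have hMpos : 0 < M := momentConst_pos α D B
  set C₁ := max 1 (Real.exp 1 * (2 * D * Real.exp 1 ^ 3) * 4 ^ (1 / α)) with hC₁def
  have hC₁ : 1 ≤ C₁ := le_max_left _ _
  set C₂ := 80 * M / δ with hC₂def
  have hC₂ : 0 < C₂ := by positivity
  set C₃ := C₁ ^ 2 / δ with hC₃def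
  have hC₃ : 0 < C₃ := by positivity
  refine ⟨C₁, C₂, C₃, 16 * (4 * C₁ ^ 2 + 4 * C₂ + C₃ + 1 / δ), by positivity, hC₂, hC₃,
    by positivity, ?_⟩
  intro p n s hp hn hs hsp ρ hρ
  have hs1 : (1 : ℝ) ≤ s := by exact_mod_cast hs
  have hs0 : (0 : ℝ) < s := by linarith
  have hsp' : (s : ℝ) ≤ p := by exact_mod_cast hsp
  have hL := one_le_log_exp_mul_div hs0 hsp'
  have hcard := mul_exp_neg_log_le hs0 hsp'
  set L := Real.log (Real.exp 1 * (p : ℝ) / (s : ℝ)) with hLdef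
  have hL0 : 0 < L := by linarith
  have hl := one_le_LL hn
  have hLsq : (L ^ (1 / α)) ^ 2 = L ^ (2 / α) := by
    rw [← Real.rpow_natCast, ← Real.rpow_mul hL0.le]
    congr 1
    push_cast
    ring
  have hL1 : 1 ≤ L ^ (2 / α) := Real.one_le_rpow hL (by positivity)
  have hsL : (s : ℝ) ≤ s * L ^ (2 / α) := le_mul_of_one_le_right hs0.le hL1
  have hsqrt : √((s : ℝ) * LL n) ≤ s + LL n := by
    rw [Real.sqrt_le_left (by linarith)]
    nlinarith
  have hadm : Admissible α D B C₁ δ p n s L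
      (C₁ * (L ^ (1 / α) + (s : ℝ) ^ (-(1 : ℝ) / 2) * √(LL n)))
      (C₂ * (√((s : ℝ) * LL n) + LL n)) (C₃ * (s : ℝ) * L ^ (2 / α)) :=
    { hα0 := hα0
      hα2 := hα2
      hD := hD
      hB := hB
      expo_le := hBle
      hC₁ := hC₁
      hDC := le_max_right _ _
      hδ0 := hδ
      hδ1 := by linarith
      hn := hn
      hs := hs0
      hL := hL
      card_le := hcard
      ha := by
        gcongr
        exact le_add_of_nonneg_right (by positivity)
      hr := fun k hk => by
        have := mul_le_mul_of_nonneg_left (expo_threshold_le hn hk hs0.le)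
          (by positivity : 0 ≤ 8 * M / δ)
        refine this.trans_eq ?_
        rw [hC₂def]
        ring
      hr₁ := by
        rw [mul_pow, hLsq, hC₃def]
        refine le_of_eq ?_
        field_simp }
  have hr0 : 0 ≤ C₂ * (√((s : ℝ) * LL n) + LL n) := by positivity
  have hsep : 2 * s * (C₁ * (L ^ (1 / α) + (s : ℝ) ^ (-(1 : ℝ) / 2) * √(LL n))) ^ 2 +
      2 * (C₂ * (√((s : ℝ) * LL n) + LL n)) + C₃ * (s : ℝ) * L ^ (2 / α) + s / δ ≤
        ρ ^ 2 / 16 := by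
    have h1 := mul_sq_threshold_le (C := C₁) (x := L ^ (1 / α)) hs1 (by linarith : 0 ≤ LL n)
    rw [hLsq] at h1
    have h2 : C₂ * (√((s : ℝ) * LL n) + LL n) ≤ C₂ * (2 * (s * L ^ (2 / α) + LL n)) := by
      gcongr
      linarith
    have h3 : C₃ * s * L ^ (2 / α) ≤ C₃ * (s * L ^ (2 / α) + LL n) := by
      rw [mul_assoc]
      gcongr
      linarith
    have h4 : (s : ℝ) / δ ≤ 1 / δ * (s * L ^ (2 / α) + LL n) := by
      rw [one_div_mul_eq_div]
      gcongr
      linarith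
    linarith
  refine (risk_le (η := 3 * δ) (by positivity)
    (fun P hP θ hθ => hadm.integral_phi_le (subWeibullNoise_of_mem_Gclass hα0 hK hP) hθ)
    (fun P hP θ hθ => hadm.integral_one_sub_phi_le (subWeibullNoise_of_mem_Gclass hα0 hK hP)
      le_rfl hr0 hsep hθ)).trans ?_
  linarith

end ChangePoint
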